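/- Let n ≥ 2, let q be a prime power, and let c be a code word of C_{n-1}(n,q) with wt(c) ≤ min{(3q−6)θ_{n-2}+2, B_{n,q}}. Then c is a linear combination of the incidence vectors of at most two distinct hyperplanes of PG(n,q). -/

import Mathlib

open scoped Classical

noncomputable section

namespace PGCode

open Projectivization

/-- The points of `PG(n, q)`, where the field `F` has order `q`. -/
abbrev Pt (F : Type) [Field F] (n : ℕ) := Projectivization F (Fin (n + 1) → F)

variable {F : Type} [Field F]

/-- A point of `PG(n,q)` lies in the projective subspace determined by a linear subspace `W`. -/
def ptIn {n : ℕ} (P : Pt F n) (W : Submodule F (Fin (n + 1) → F)) : Prop :=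
  Projectivization.submodule P ≤ W

/-- The set of points of the projective subspace determined by a linear subspace `W`. -/
def ptsIn {n : ℕ} (W : Submodule F (Fin (n + 1) → F)) : Set (Pt F n) :=
  {P | ptIn P W}

/-- The incidence vector (over `F_p = ZMod p`) of the projective subspace determined by `W`. -/
def incVec (p : ℕ) {n : ℕ} (W : Submodule F (Fin (n + 1) → F)) : Pt F n → ZMod p :=
  fun P => if ptIn P W then (1 : ZMod p) else 0

/-- The code `C_{n-1}(n,q)`: the `F_p`-span of the incidence vectors of all hyperplanes
(projective dimension `n-1`, i.e. linear dimension `n`). -/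
def code (F : Type) [Field F] (p n : ℕ) : Submodule (ZMod p) (Pt F n → ZMod p) :=
  Submodule.span (ZMod p)
    {v | ∃ W : Submodule F (Fin (n + 1) → F), Module.finrank F W = n ∧ v = incVec p W}

/-- The support of a word. -/
def supp {p n : ℕ} (v : Pt F n → ZMod p) : Set (Pt F n) := {P | v P ≠ 0}

/-- The weight of a word. -/
def wt {p n : ℕ} (v : Pt F n → ZMod p) : ℕ := (supp v).ncard

/-- The weight of the restriction of a word to the subspace determined by `W`. -/
def wtRes {p n : ℕ} (c : Pt F n → ZMod p) (W : Submodule F (Fin (n + 1) → F)) : ℕ :=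
  (ptsIn W ∩ supp c).ncard

/-- `θ_m = (q^(m+1) - 1)/(q - 1)`, with `θ_m = 0` for `m < 0`. -/
def theta (q : ℕ) (m : ℤ) : ℕ :=
  if m < 0 then 0 else ∑ i ∈ Finset.range (m.toNat + 1), q ^ i

/-- The bound `B_{n,q}` from the paper. -/
def B (n q : ℕ) : ℝ :=
  if q < 7 ∨ q = 8 ∨ q = 9 ∨ q = 16 ∨ q = 25 ∨ q = 27 ∨ q = 49 then
    2 * (q : ℝ) ^ (n - 1)
  else if q = 7 ∨ q = 11 ∨ q = 13 ∨ q = 17 then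
    (3 * q - Real.sqrt (6 * q) - 1 / 2) * (q : ℝ) ^ (n - 2)
  else if q = 19 ∨ q = 121 then
    (3 * q - Real.sqrt (6 * q) + 9 / 2) * (q : ℝ) ^ (n - 2)
  else if q = 29 ∨ q = 31 ∨ q = 32 then
    (4 * q - 4 * Real.sqrt q - 25 / 2) * (q : ℝ) ^ (n - 2)
  else
    (4 * q - Real.sqrt (8 * q) - 33 / 2) * (q : ℝ) ^ (n - 2)

/-- A line of `PG(n,q)`: a linear subspace of dimension `2`. -/
def IsLine {n : ℕ} (l : Submodule F (Fin (n + 1) → F)) : Prop := Module.finrank F l = 2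

/-- A plane of `PG(n,q)`: a linear subspace of dimension `3`. -/
def IsPlane {n : ℕ} (W : Submodule F (Fin (n + 1) → F)) : Prop := Module.finrank F W = 3

/-- The line `l` is an `α`-secant to `supp c`. -/
def secant {p n : ℕ} (c : Pt F n → ZMod p) (l : Submodule F (Fin (n + 1) → F)) (α : ℕ) : Prop :=
  IsLine l ∧ (ptsIn l ∩ supp c).ncard = α

/-- The restriction of `c` to the plane `W` is a linear combination of at most two lines of `W`. -/
def TwoLineComb (p : ℕ) {n : ℕ} (c : Pt F n → ZMod p) (W : Submodule F (Fin (n + 1) → F)) :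
    Prop :=
  ∃ l₁ l₂ : Submodule F (Fin (n + 1) → F), IsLine l₁ ∧ IsLine l₂ ∧ l₁ ≤ W ∧ l₂ ≤ W ∧
    ∃ a b : ZMod p, ∀ P : Pt F n, ptIn P W → c P = a * incVec p l₁ P + b * incVec p l₂ P

/-- Type `T^△`: the restriction of `c` to the plane `W` is a linear combination (with nonzero
coefficients) of three nonconcurrent lines of `W`. -/
def TypeTri (p : ℕ) {n : ℕ} (c : Pt F n → ZMod p) (W : Submodule F (Fin (n + 1) → F)) : Prop :=
  ∃ l₁ l₂ l₃ : Submodule F (Fin (n + 1) → F),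
    IsLine l₁ ∧ IsLine l₂ ∧ IsLine l₃ ∧ l₁ ≤ W ∧ l₂ ≤ W ∧ l₃ ≤ W ∧
    l₁ ≠ l₂ ∧ l₁ ≠ l₃ ∧ l₂ ≠ l₃ ∧
    (¬ ∃ P : Pt F n, ptIn P l₁ ∧ ptIn P l₂ ∧ ptIn P l₃) ∧
    ∃ a₁ a₂ a₃ : ZMod p, a₁ ≠ 0 ∧ a₂ ≠ 0 ∧ a₃ ≠ 0 ∧
      ∀ P : Pt F n, ptIn P W →
        c P = a₁ * incVec p l₁ P + a₂ * incVec p l₂ P + a₃ * incVec p l₃ P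

/-- Type `T^★`: the restriction of `c` to the plane `W` is a linear combination (with nonzero
coefficients) of three distinct concurrent lines of `W`. -/
def TypeStar (p : ℕ) {n : ℕ} (c : Pt F n → ZMod p) (W : Submodule F (Fin (n + 1) → F)) : Prop :=
  ∃ l₁ l₂ l₃ : Submodule F (Fin (n + 1) → F),
    IsLine l₁ ∧ IsLine l₂ ∧ IsLine l₃ ∧ l₁ ≤ W ∧ l₂ ≤ W ∧ l₃ ≤ W ∧
    l₁ ≠ l₂ ∧ l₁ ≠ l₃ ∧ l₂ ≠ l₃ ∧
    (∃ P : Pt F n, ptIn P l₁ ∧ ptIn P l₂ ∧ ptIn P l₃) ∧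
    ∃ a₁ a₂ a₃ : ZMod p, a₁ ≠ 0 ∧ a₂ ≠ 0 ∧ a₃ ≠ 0 ∧
      ∀ P : Pt F n, ptIn P W →
        c P = a₁ * incVec p l₁ P + a₂ * incVec p l₂ P + a₃ * incVec p l₃ P

/-- The base code word `c₀` of the `T^odd` construction on `PG(2,p)`:
`c₀(0,1,a) = a`, `c₀(1,0,b) = b`, `c₀(1,1,c) = -c`, and `c₀ = 0` elsewhere. -/
def oddBase (p : ℕ) [Fact p.Prime] : Pt (ZMod p) 2 → ZMod p := fun P =>
  if P.rep 0 = 0 ∧ P.rep 1 ≠ 0 then P.rep 2 / P.rep 1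
  else if P.rep 1 = 0 ∧ P.rep 0 ≠ 0 then P.rep 2 / P.rep 0
  else if P.rep 0 = P.rep 1 ∧ P.rep 0 ≠ 0 then -(P.rep 2 / P.rep 0)
  else 0

/-- The line `m : X₀ = 0` of `PG(2,p)`. -/
def lineM1 (p : ℕ) [Fact p.Prime] : Submodule (ZMod p) (Fin 3 → ZMod p) :=
  LinearMap.ker (LinearMap.proj 0 : (Fin 3 → ZMod p) →ₗ[ZMod p] ZMod p)

/-- The line `m' : X₁ = 0` of `PG(2,p)`. -/
def lineM2 (p : ℕ) [Fact p.Prime] : Submodule (ZMod p) (Fin 3 → ZMod p) :=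
  LinearMap.ker (LinearMap.proj 1 : (Fin 3 → ZMod p) →ₗ[ZMod p] ZMod p)

/-- The line `m'' : X₀ = X₁` of `PG(2,p)`. -/
def lineM3 (p : ℕ) [Fact p.Prime] : Submodule (ZMod p) (Fin 3 → ZMod p) :=
  LinearMap.ker ((LinearMap.proj 0 : (Fin 3 → ZMod p) →ₗ[ZMod p] ZMod p) - LinearMap.proj 1)

/-- The code word `d = (γ c₀ + λ m + λ' m' + λ'' m'')^π` of the `T^odd` construction, where the
collineation `π` of `PG(2,p)` is the inverse of the homography induced by the linear
equivalence `g`. -/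
def oddWord (p : ℕ) [Fact p.Prime] (g : (Fin 3 → ZMod p) ≃ₗ[ZMod p] (Fin 3 → ZMod p))
    (γ lam lam' lam'' : ZMod p) : Pt (ZMod p) 2 → ZMod p := fun P =>
  γ * oddBase p (Projectivization.map g.toLinearMap g.injective P) +
    lam * incVec p (lineM1 p) (Projectivization.map g.toLinearMap g.injective P) +
    lam' * incVec p (lineM2 p) (Projectivization.map g.toLinearMap g.injective P) +
    lam'' * incVec p (lineM3 p) (Projectivization.map g.toLinearMap g.injective P)

/-- The semilinear embedding of `PG(2,p)` onto the plane of `PG(n,q)` spanned by the linearly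
independent vectors `b 0, b 1, b 2`, relative to the field embedding `σ : F_p → F`. -/
def planeEmbed {n : ℕ} {p : ℕ} [Fact p.Prime] (σ : ZMod p →+* F)
    (b : Fin 3 → (Fin (n + 1) → F)) (hb : LinearIndependent F b) :
    Pt (ZMod p) 2 → Pt F n := fun P =>
  Projectivization.mk F (∑ i, σ (P.rep i) • b i) (by
    intro hzero
    have h0 : ∀ i ∈ Finset.univ, σ (P.rep i) = 0 :=
      linearIndependent_iff'.mp hb Finset.univ (fun i => σ (P.rep i)) hzero
    have h1 : P.rep = 0 := funext fun i => σ.injective (by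
      simp only [Pi.zero_apply, map_zero]; exact h0 i (Finset.mem_univ i))
    exact P.rep_nonzero h1)

/-- Type `T^odd`: this requires `q = p` to be prime (`|F| = p`), and `c` restricted to the plane
`W` (spanned by the frame `b`) must coincide, via a semilinear identification of `W` with
`PG(2,p)`, with a code word `d` of the `T^odd` construction. -/
def TypeOdd (p : ℕ) [Fact p.Prime] [Fintype F] {n : ℕ} (c : Pt F n → ZMod p)
    (W : Submodule F (Fin (n + 1) → F)) : Prop :=
  Fintype.card F = p ∧
  ∃ (σ : ZMod p →+* F) (b : Fin 3 → (Fin (n + 1) → F)) (hb : LinearIndependent F b),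
    Submodule.span F (Set.range b) = W ∧
    ∃ (g : (Fin 3 → ZMod p) ≃ₗ[ZMod p] (Fin 3 → ZMod p)) (γ lam lam' lam'' : ZMod p), γ ≠ 0 ∧
      ∀ Q : Pt (ZMod p) 2, c (planeEmbed σ b hb Q) = oddWord p g γ lam lam' lam'' Q

/-- The list of plane types `T_0, T_{q+1}, T_{2q}, T_{2q+1}, T^odd, T^△, T^★`. -/
inductive PlaneT : Type where
  | T0 | Tq1 | T2q | T2q1 | Todd | Ttri | Tstar
deriving DecidableEq

/-- The restriction of `c` to the plane `W` is a code word of the given type. -/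
def PlaneIsType (p q : ℕ) [Fact p.Prime] [Fintype F] {n : ℕ} (c : Pt F n → ZMod p)
    (W : Submodule F (Fin (n + 1) → F)) : PlaneT → Prop
  | .T0 => TwoLineComb p c W ∧ wtRes c W = 0
  | .Tq1 => TwoLineComb p c W ∧ wtRes c W = q + 1
  | .T2q => TwoLineComb p c W ∧ wtRes c W = 2 * q
  | .T2q1 => TwoLineComb p c W ∧ wtRes c W = 2 * q + 1
  | .Todd => TypeOdd p c W
  | .Ttri => TypeTri p c W
  | .Tstar => TypeStar p c W

/-- The plane `W` is of type `𝒯`. -/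
def TypeT (p q : ℕ) [Fact p.Prime] [Fintype F] {n : ℕ} (c : Pt F n → ZMod p)
    (W : Submodule F (Fin (n + 1) → F)) : Prop :=
  IsPlane W ∧ ∃ t : PlaneT, PlaneIsType p q c W t

/-- The plane `W` is of type `𝒪`. -/
def TypeO (p q : ℕ) [Fact p.Prime] [Fintype F] {n : ℕ} (c : Pt F n → ZMod p)
    (W : Submodule F (Fin (n + 1) → F)) : Prop :=
  IsPlane W ∧ ¬ TypeT p q c W

/-- The restriction of `c` to the `k`-space `Sp` (linear dimension `k+1`) is of type `t`:
there is a `(k-3)`-space `κ ⊆ Sp` on which `c` is a scalar multiple of the all-one function,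
a plane `π ⊆ Sp` of type `t` disjoint from `κ`, and `c P = c (⟨κ, P⟩ ∩ π)` for every point
`P` of `Sp` outside `κ`. -/
def SpaceIsType (p q : ℕ) [Fact p.Prime] [Fintype F] {n : ℕ} (c : Pt F n → ZMod p)
    (Sp : Submodule F (Fin (n + 1) → F)) (k : ℕ) (t : PlaneT) : Prop :=
  Module.finrank F Sp = k + 1 ∧
  ∃ κ : Submodule F (Fin (n + 1) → F), Module.finrank F κ = k - 2 ∧ κ ≤ Sp ∧
    (∃ a : ZMod p, ∀ P : Pt F n, ptIn P κ → c P = a) ∧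
    ∃ π : Submodule F (Fin (n + 1) → F), IsPlane π ∧ π ≤ Sp ∧ π ⊓ κ = ⊥ ∧
      PlaneIsType p q c π t ∧
      ∀ P : Pt F n, ptIn P Sp → ¬ ptIn P κ →
        ∃ Q : Pt F n, ptIn Q π ∧
          Projectivization.submodule Q ≤ κ ⊔ Projectivization.submodule P ∧ c P = c Q


section Hankel

open Polynomial

theorem pow_dvd_det_of_rank_le {K : Type*} [Field K] {n : ℕ} (M : Matrix (Fin n) (Fin n) K[X])
    (y : K) (r : ℕ) (hr : (M.map (eval y)).rank ≤ r) : (X - C y) ^ (n - r) ∣ M.det := by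
  obtain ⟨L, L', D, h⟩ :=
    Matrix.Pivot.exists_list_transvec_mul_mul_list_transvec_eq_diagonal (M.map (eval y))
  set A := (L.map Matrix.TransvectionStruct.toMatrix).prod with hA
  set B := (L'.map Matrix.TransvectionStruct.toMatrix).prod with hB
  have dA : A.det = 1 := Matrix.TransvectionStruct.det_toMatrix_prod L
  have dB : B.det = 1 := Matrix.TransvectionStruct.det_toMatrix_prod L'
  have hrank : (Matrix.diagonal D).rank = (M.map (eval y)).rank := by
    rw [← h, Matrix.rank_mul_eq_left_of_isUnit_det _ _ (by simp [dB]),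
      Matrix.rank_mul_eq_right_of_isUnit_det _ _ (by simp [dA])]
  set N := A.map C * M * B.map C with hN
  have dN : N.det = M.det := by
    have hC : ∀ Z : Matrix (Fin n) (Fin n) K, Z.det = 1 → (Z.map (C : K → K[X])).det = 1 := by
      intro Z hZ
      have := RingHom.map_det (C : K →+* K[X]) Z
      rw [hZ, map_one] at this
      exact this.symm
    rw [hN, Matrix.det_mul, Matrix.det_mul, hC A dA, hC B dB]; ring
  have hNy : N.map (eval y) = Matrix.diagonal D := by
    have e : ∀ Z : Matrix (Fin n) (Fin n) K[X], Z.map (eval y) = Z.map (evalRingHom y) := by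
      intro Z; rfl
    have e2 : ∀ Z : Matrix (Fin n) (Fin n) K, (Z.map (C : K → K[X])).map (evalRingHom y) = Z := by
      intro Z; ext i j; simp
    rw [← h, e, e, hN, Matrix.map_mul, Matrix.map_mul, e2, e2]
  have hdvd : ∀ i j, (if D i = 0 then (X - C y : K[X]) else 1) ∣ N i j := by
    intro i j
    split_ifs with hi
    · rw [dvd_iff_isRoot, IsRoot.def]
      have := congrFun (congrFun hNy i) j
      rw [Matrix.map_apply] at this
      rw [this, Matrix.diagonal_apply]
      split_ifs <;> simp [hi]
    · exact one_dvd _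
  choose N' hN' using hdvd
  have hdet : N.det = (∏ i, if D i = 0 then (X - C y : K[X]) else 1) * (Matrix.of N').det := by
    rw [← Matrix.det_mul_column]
    congr 1
    ext1 i
    intro j
    exact hN' i j
  rw [← dN, hdet]
  refine Dvd.dvd.mul_right ?_ _
  rw [Finset.prod_ite]
  simp only [Finset.prod_const, one_pow, mul_one]
  apply pow_dvd_pow
  rw [Matrix.rank_diagonal] at hrank
  have hc : (Finset.univ.filter fun i => D i = 0).card + Fintype.card {i // D i ≠ 0} = n := by
    rw [Fintype.card_subtype, Finset.card_filter_add_card_filter_not, Finset.card_univ,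
      Fintype.card_fin]
  omega

theorem natDegree_hankel_det_le {K : Type*} [Field K] (P : ℕ → K[X])
    (hP : ∀ m, (P m).natDegree ≤ m) (s : ℕ) :
    (Matrix.of fun i j : Fin s => P (i + j)).det.natDegree ≤ s * (s - 1) := by
  rw [Matrix.det_apply]
  refine natDegree_sum_le_of_forall_le _ _ ?_
  intro σ _
  refine (natDegree_smul_le _ _).trans ?_
  refine (natDegree_prod_le _ _).trans ?_
  calc ∑ i, (Matrix.of (fun i j : Fin s => P (i + j)) (σ i) i).natDegree
      ≤ ∑ i : Fin s, (((σ i : Fin s) : ℕ) + (i : ℕ)) := Finset.sum_le_sum fun i _ => hP _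
    _ = (∑ i : Fin s, (i : ℕ)) + ∑ i : Fin s, (i : ℕ) := by
        rw [Finset.sum_add_distrib, Equiv.sum_comp σ (fun i : Fin s => (i : ℕ))]
    _ = s * (s - 1) := by
        rw [← Finset.sum_range (fun i => i), ← Finset.sum_range_id_mul_two, mul_two]

/-- Functions on an affine plane whose moments along the lines of a parallel class are
polynomials of small degree in the parameter of the line. -/
def HasMoments {K : Type*} [Field K] [Fintype K] (G : K → K → K) : Prop :=
  ∀ m : ℕ, ∃ P : K[X], P.natDegree ≤ m ∧ ∀ y, P.eval y = ∑ x, G x y * x ^ m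

theorem HasMoments.card_le {K : Type*} [Field K] [Fintype K] {G : K → K → K}
    (hG : HasMoments G) (y₀ : K) {t : ℕ}
    (ht : (Finset.univ.filter fun x => G x y₀ ≠ 0).card = t) :
    t * (Fintype.card K + 1 - t) ≤ ∑ y, (Finset.univ.filter fun x => G x y ≠ 0).card := by
  choose P hPdeg hP using hG
  set M : Matrix (Fin t) (Fin t) K[X] := Matrix.of fun i j : Fin t => P (i + j) with hM
  set τ : K → ℕ := fun y => (Finset.univ.filter fun x => G x y ≠ 0).card with hτ
  have hMy : ∀ y, M.map (eval y) = Matrix.of fun i j : Fin t => ∑ x, G x y * x ^ (i + j : ℕ) := by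
    intro y; ext i j; simp [hM, hP]
  have hrank : ∀ y, (M.map (eval y)).rank ≤ τ y := by
    intro y
    have : M.map (eval y) =
        (Matrix.of fun (i : Fin t) (x : {x // G x y ≠ 0}) => (x : K) ^ (i : ℕ)) *
        (Matrix.of fun (x : {x // G x y ≠ 0}) (j : Fin t) => G x y * (x : K) ^ (j : ℕ)) := by
      rw [hMy]
      ext i j
      simp only [Matrix.of_apply, Matrix.mul_apply]
      rw [← Finset.sum_filter_add_sum_filter_not Finset.univ (fun x => G x y ≠ 0),
        Finset.sum_subtype (Finset.univ.filter fun x => G x y ≠ 0) (p := fun x => G x y ≠ 0)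
          (by simp), Finset.sum_eq_zero (s := Finset.univ.filter fun x => ¬ (G x y ≠ 0)), add_zero]
      · refine Finset.sum_congr rfl fun x _ => ?_
        rw [pow_add]; ring
      · intro x hx
        have : G x y = 0 := by simpa using hx
        simp [this]
    rw [this]
    refine (Matrix.rank_mul_le_left _ _).trans ?_
    refine (Matrix.rank_le_card_width _).trans ?_
    rw [Fintype.card_subtype]
  have hdet : M.det ≠ 0 := by
    intro h0
    have h1 : (M.map (eval y₀)).det = 0 := by
      have := RingHom.map_det (evalRingHom y₀) M
      rw [h0, map_zero] at this
      exact this.symm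
    let e : Fin t ≃ {x // G x y₀ ≠ 0} := by
      refine Fintype.equivOfCardEq ?_
      rw [Fintype.card_subtype, ht, Fintype.card_fin]
    have h2 : M.map (eval y₀) = (Matrix.vandermonde fun i => ((e i : _) : K)).transpose *
        (Matrix.diagonal (fun i => G (e i) y₀) * (Matrix.vandermonde fun i => ((e i : _) : K))) := by
      rw [hMy]
      ext i j
      rw [Matrix.mul_apply]
      simp only [Matrix.of_apply, Matrix.diagonal_mul, Matrix.transpose_apply,
        Matrix.vandermonde_apply]
      rw [← Finset.sum_filter_add_sum_filter_not Finset.univ (fun x => G x y₀ ≠ 0),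
        Finset.sum_subtype (Finset.univ.filter fun x => G x y₀ ≠ 0) (p := fun x => G x y₀ ≠ 0)
          (by simp), Finset.sum_eq_zero (s := Finset.univ.filter fun x => ¬ (G x y₀ ≠ 0)), add_zero]
      · rw [← Equiv.sum_comp e]
        refine Finset.sum_congr rfl fun x _ => ?_
        rw [pow_add]; ring
      · intro x hx
        have : G x y₀ = 0 := by simpa using hx
        simp [this]
    rw [h2, Matrix.det_mul, Matrix.det_mul, Matrix.det_transpose, Matrix.det_diagonal] at h1
    have h3 : (Matrix.vandermonde fun i => ((e i : _) : K)).det ≠ 0 := by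
      rw [Matrix.det_vandermonde_ne_zero_iff]
      exact Subtype.val_injective.comp e.injective
    have h4 : (∏ i, G (e i) y₀) ≠ 0 := Finset.prod_ne_zero_iff.mpr fun i _ => (e i).2
    exact mul_ne_zero h3 (mul_ne_zero h4 h3) h1
  have hmult : ∑ y, (t - τ y) ≤ t * (t - 1) := by
    calc ∑ y, (t - τ y) ≤ ∑ y, M.det.roots.count y := by
          refine Finset.sum_le_sum fun y _ => ?_
          rw [count_roots, le_rootMultiplicity_iff hdet]
          exact pow_dvd_det_of_rank_le M y _ (hrank y)
      _ = M.det.roots.card := Multiset.sum_count_eq_card fun a _ => Finset.mem_univ a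
      _ ≤ M.det.natDegree := card_roots' _
      _ ≤ t * (t - 1) := natDegree_hankel_det_le P hPdeg t
  have hsum : Fintype.card K * t ≤ ∑ y, (t - τ y) + ∑ y, τ y := by
    rw [← Finset.sum_add_distrib]
    calc Fintype.card K * t = ∑ _y : K, t := by simp
      _ ≤ _ := Finset.sum_le_sum fun y _ => by omega
  have htq : t ≤ Fintype.card K := by
    rw [← ht]; exact Finset.card_le_univ _
  have : t * (Fintype.card K + 1 - t) + t * (t - 1) = Fintype.card K * t := by
    rcases Nat.eq_zero_or_pos t with h | h
    · simp [h]
    · rw [← mul_add, mul_comm]; congr 1; omega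
  change t * (Fintype.card K + 1 - t) ≤ ∑ y, τ y
  omega

theorem HasMoments.zero {K : Type*} [Field K] [Fintype K] :
    HasMoments (fun _ _ : K => (0 : K)) := fun m => ⟨0, by simp, by simp⟩

theorem HasMoments.add {K : Type*} [Field K] [Fintype K] {G H : K → K → K}
    (hG : HasMoments G) (hH : HasMoments H) : HasMoments (fun x y => G x y + H x y) := by
  intro m
  obtain ⟨P, hP, hP'⟩ := hG m
  obtain ⟨Q, hQ, hQ'⟩ := hH m
  refine ⟨P + Q, natDegree_add_le_of_degree_le hP hQ, fun y => ?_⟩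
  rw [eval_add, hP', hQ', ← Finset.sum_add_distrib]
  exact Finset.sum_congr rfl fun x _ => by ring

theorem HasMoments.smul {K : Type*} [Field K] [Fintype K] {G : K → K → K} (a : K)
    (hG : HasMoments G) : HasMoments (fun x y => a * G x y) := by
  intro m
  obtain ⟨P, hP, hP'⟩ := hG m
  refine ⟨C a * P, (natDegree_C_mul_le _ _).trans hP, fun y => ?_⟩
  rw [eval_C_mul, hP', Finset.mul_sum]
  exact Finset.sum_congr rfl fun x _ => by ring

/-- The indicator function of an affine line (or of the empty set, or of the whole plane). -/
theorem hasMoments_line {K : Type*} [Field K] [Fintype K] (a b d : K) :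
    HasMoments (fun x y : K => if a * x + b * y + d = 0 then (1 : K) else 0) := by
  intro m
  by_cases ha : a = 0
  · refine ⟨C (∑ x : K, x ^ m) * (1 - (C b * X + C d) ^ (Fintype.card K - 1)), ?_, ?_⟩
    · by_cases hm : m < Fintype.card K - 1
      · rw [FiniteField.sum_pow_lt_card_sub_one K m hm]; simp
      · refine (natDegree_C_mul_le _ _).trans ?_
        refine (natDegree_sub_le _ _).trans ?_
        rw [natDegree_one, Nat.zero_max]
        refine natDegree_pow_le.trans ?_
        calc (Fintype.card K - 1) * (C b * X + C d).natDegree ≤ (Fintype.card K - 1) * 1 :=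
              Nat.mul_le_mul_left _ natDegree_linear_le
          _ ≤ m := by omega
    · intro y
      have hcard : Fintype.card K - 1 ≠ 0 := by
        have := Fintype.one_lt_card (α := K); omega
      have hx : ∀ x : K, a * x + b * y + d = b * y + d := by intro x; rw [ha]; ring
      simp only [hx, eval_mul, eval_C, eval_sub, eval_one, eval_pow, eval_add, eval_X]
      split_ifs with h
      · rw [h, zero_pow hcard]; simp
      · rw [FiniteField.pow_card_sub_one_eq_one _ h]; simp
  · refine ⟨(C (-a⁻¹ * b) * X + C (-a⁻¹ * d)) ^ m, ?_, ?_⟩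
    · exact natDegree_pow_le.trans
        ((Nat.mul_le_mul_left _ natDegree_linear_le).trans (by omega))
    · intro y
      rw [Finset.sum_eq_single (-a⁻¹ * b * y + -a⁻¹ * d)]
      · beta_reduce
        rw [if_pos (by linear_combination (-(b * y + d)) * mul_inv_cancel₀ ha)]; simp
      · intro x _ hx
        beta_reduce
        rw [if_neg, zero_mul]
        intro h
        apply hx
        have : a * x = -(b * y + d) := by linear_combination h
        have : x = a⁻¹ * (-(b * y + d)) := by rw [← this]; field_simp
        rw [this]; ring
      · simp

end Hankel

section Plane

/-- A projective plane of order `q` with point set `π` and lines `Λ`, together with a set `S` of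
points satisfying the inequality of `HasMoments.card_le` for every pair of distinct lines. -/
structure HankelPlane {X : Type*} (q : ℕ) (π S : Finset X) (Λ : Finset (Finset X)) : Prop where
  sub : ∀ l ∈ Λ, l ⊆ π
  card_line : ∀ l ∈ Λ, l.card = q + 1
  join : ∀ P ∈ π, ∀ Q ∈ π, P ≠ Q → ∃ l ∈ Λ, P ∈ l ∧ Q ∈ l
  meet : ∀ l ∈ Λ, ∀ m ∈ Λ, l ≠ m → ∃ P, l ∩ m = {P}
  card_plane : π.card = q ^ 2 + q + 1
  S_sub : S ⊆ π
  hankel : ∀ g ∈ Λ, ∀ m ∈ Λ, g ≠ m →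
    ((g ∩ S) \ m).card * (q + 1 - ((g ∩ S) \ m).card) ≤ (S \ m).card

namespace HankelPlane

variable {X : Type*} {q : ℕ} {π S : Finset X} {Λ : Finset (Finset X)}

theorem eq_of_mem (H : HankelPlane q π S Λ) {l m : Finset X} (hl : l ∈ Λ) (hm : m ∈ Λ) {P Q : X}
    (hPQ : P ≠ Q) (hPl : P ∈ l) (hQl : Q ∈ l) (hPm : P ∈ m) (hQm : Q ∈ m) : l = m := by
  by_contra h
  obtain ⟨R, hR⟩ := H.meet l hl m hm h
  have h1 : P ∈ l ∩ m := Finset.mem_inter.2 ⟨hPl, hPm⟩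
  have h2 : Q ∈ l ∩ m := Finset.mem_inter.2 ⟨hQl, hQm⟩
  rw [hR, Finset.mem_singleton] at h1 h2
  exact hPQ (h1.trans h2.symm)

theorem eq_point (H : HankelPlane q π S Λ) {l m : Finset X} (hl : l ∈ Λ) (hm : m ∈ Λ)
    (hlm : l ≠ m) {P Q : X} (hPl : P ∈ l) (hQl : Q ∈ l) (hPm : P ∈ m) (hQm : Q ∈ m) : P = Q := by
  by_contra h
  exact hlm (H.eq_of_mem hl hm h hPl hQl hPm hQm)

theorem exists_meet (H : HankelPlane q π S Λ) {l m : Finset X} (hl : l ∈ Λ) (hm : m ∈ Λ)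
    (hlm : l ≠ m) : ∃ P, P ∈ l ∧ P ∈ m := by
  obtain ⟨R, hR⟩ := H.meet l hl m hm hlm
  have : R ∈ l ∩ m := by simp [hR]
  exact ⟨R, Finset.mem_inter.1 this⟩

theorem card_inter_le_one (H : HankelPlane q π S Λ) {l m : Finset X} (hl : l ∈ Λ) (hm : m ∈ Λ)
    (hlm : l ≠ m) : (l ∩ m).card ≤ 1 := by
  obtain ⟨R, hR⟩ := H.meet l hl m hm hlm
  simp [hR]

/-- The lines through a point. -/
def pencil (Λ : Finset (Finset X)) (P : X) : Finset (Finset X) := Λ.filter fun l => P ∈ l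

theorem mem_pencil {P : X} {l : Finset X} : l ∈ pencil Λ P ↔ l ∈ Λ ∧ P ∈ l := by
  simp [pencil]

theorem sum_pencil (H : HankelPlane q π S Λ) {P : X} (hP : P ∈ π) {T : Finset X} (hT : T ⊆ π) :
    ∑ g ∈ pencil Λ P, ((g ∩ T) \ {P}).card = (T \ {P}).card := by
  rw [← Finset.card_biUnion]
  · congr 1
    ext Q
    simp only [Finset.mem_biUnion, mem_pencil, Finset.mem_sdiff, Finset.mem_inter,
      Finset.mem_singleton]
    constructor
    · rintro ⟨g, _, ⟨_, h⟩, h'⟩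
      exact ⟨h, h'⟩
    · rintro ⟨h, h'⟩
      obtain ⟨l, hl, h1, h2⟩ := H.join P hP Q (hT h) (Ne.symm h')
      exact ⟨l, ⟨hl, h1⟩, ⟨h2, h⟩, h'⟩
  · intro g hg g' hg' hne
    rw [Function.onFun, Finset.disjoint_left]
    intro Q hQ hQ'
    simp only [Finset.mem_sdiff, Finset.mem_inter, Finset.mem_singleton] at hQ hQ'
    have hg := mem_pencil.1 (Finset.mem_coe.1 hg)
    have hg' := mem_pencil.1 (Finset.mem_coe.1 hg')
    exact hQ.2 (H.eq_point hg.1 hg'.1 hne hQ.1.1 hg.2 hQ'.1.1 hg'.2)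

theorem card_pencil (H : HankelPlane q π S Λ) (hq : 0 < q) {P : X} (hP : P ∈ π) :
    (pencil Λ P).card = q + 1 := by
  have h := H.sum_pencil hP (Finset.Subset.refl π)
  rw [Finset.sum_congr rfl (g := fun _ => q), Finset.sum_const, smul_eq_mul,
    Finset.card_sdiff_of_subset (by simpa using hP), H.card_plane, Finset.card_singleton] at h
  · have : (pencil Λ P).card * q = (q + 1) * q := by rw [h]; simp; ring
    exact Nat.eq_of_mul_eq_mul_right hq this
  · intro g hg
    have hg := mem_pencil.1 hg
    rw [Finset.inter_eq_left.2 (H.sub g hg.1), Finset.card_sdiff_of_subset (by simpa using hg.2),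
      H.card_line g hg.1]
    simp

theorem exists_line_avoiding (H : HankelPlane q π S Λ) (hq : 0 < q) {P : X} (hP : P ∈ π)
    (T : Finset X) (hT : T.card ≤ q) : ∃ g ∈ Λ, P ∈ g ∧ ∀ Y ∈ T, Y ≠ P → Y ∉ g := by
  by_contra! hcon
  have hch : ∀ g ∈ pencil Λ P, ∃ Y ∈ T, Y ≠ P ∧ Y ∈ g := by
    intro g hg
    have hg := mem_pencil.1 hg
    exact hcon g hg.1 hg.2
  have : Nonempty X := ⟨P⟩
  choose! f hf1 hf2 hf3 using hch
  have := Finset.card_le_card_of_injOn f hf1 (by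
    intro g hg g' hg' he
    have h1 := mem_pencil.1 (Finset.mem_coe.1 hg)
    have h2 := mem_pencil.1 (Finset.mem_coe.1 hg')
    exact H.eq_of_mem h1.1 h2.1 (hf2 g hg) (hf3 g hg) h1.2 (he ▸ hf3 g' hg') h2.2)
  rw [H.card_pencil hq hP] at this
  omega

theorem exists_line_ne (H : HankelPlane q π S Λ) (hq : 0 < q) {P : X} (hP : P ∈ π)
    (l : Finset X) : ∃ g ∈ Λ, P ∈ g ∧ g ≠ l := by
  have h : 1 < (pencil Λ P).card := by rw [H.card_pencil hq hP]; omega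
  obtain ⟨g, hg, hne⟩ := Finset.exists_mem_ne h l
  exact ⟨g, (mem_pencil.1 hg).1, (mem_pencil.1 hg).2, hne⟩

theorem exists_other_line (H : HankelPlane q π S Λ) (hq : 0 < q) {l : Finset X} (hl : l ∈ Λ) :
    ∃ g ∈ Λ, g ≠ l := by
  have : l.Nonempty := by rw [← Finset.card_pos, H.card_line l hl]; omega
  obtain ⟨P, hP⟩ := this
  obtain ⟨g, hg, _, h⟩ := H.exists_line_ne hq (H.sub l hl hP) l
  exact ⟨g, hg, h⟩

theorem card_le_of_pencil (H : HankelPlane q π S Λ) (hq : 0 < q) {P : X} {T : Finset X}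
    (hT : T ⊆ π) (hP : P ∈ T) {k : ℕ} (h : ∀ g ∈ Λ, P ∈ g → (g ∩ T).card ≤ k + 1) :
    T.card ≤ 1 + (q + 1) * k := by
  have h1 := H.sum_pencil (hT hP) hT
  have h2 : ∑ g ∈ pencil Λ P, ((g ∩ T) \ {P}).card ≤ ∑ g ∈ pencil Λ P, k := by
    refine Finset.sum_le_sum fun g hg => ?_
    have hg := mem_pencil.1 hg
    rw [Finset.card_sdiff_of_subset (by simp [hP, hg.2]), Finset.card_singleton]
    have := h g hg.1 hg.2
    omega
  rw [Finset.sum_const, smul_eq_mul, H.card_pencil hq (hT hP), h1,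
    Finset.card_sdiff_of_subset (by simpa using hP), Finset.card_singleton] at h2
  omega

theorem two_lines (H : HankelPlane q π S Λ) {m₁ m₂ T : Finset X} (h₁ : m₁ ∈ Λ) (h₂ : m₂ ∈ Λ)
    (h₁₂ : m₁ ≠ m₂) : (m₁ ∩ T).card + (m₂ ∩ T).card ≤ T.card + 1 := by
  rw [← Finset.card_union_add_card_inter]
  refine add_le_add (Finset.card_le_card ?_) ((Finset.card_le_card ?_).trans
    (H.card_inter_le_one h₁ h₂ h₁₂))
  · intro Q; simp only [Finset.mem_union, Finset.mem_inter]; tauto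
  · intro Q; simp only [Finset.mem_inter]; tauto

theorem three_lines (H : HankelPlane q π S Λ) {m₁ m₂ m₃ T : Finset X} (h₁ : m₁ ∈ Λ) (h₂ : m₂ ∈ Λ)
    (h₃ : m₃ ∈ Λ) (h₁₃ : m₁ ≠ m₃) (h₂₃ : m₂ ≠ m₃) :
    (m₁ ∩ T).card + (m₂ ∩ T).card + (m₃ ∩ T).card ≤ T.card + 2 + (m₁ ∩ m₂ ∩ T).card := by
  have e1 := Finset.card_union_add_card_inter (m₁ ∩ T) (m₂ ∩ T)
  have e2 := Finset.card_union_add_card_inter (m₁ ∩ T ∪ m₂ ∩ T) (m₃ ∩ T)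
  have e3 : (m₁ ∩ T ∪ m₂ ∩ T ∪ m₃ ∩ T).card ≤ T.card := Finset.card_le_card (by
    intro Q; simp only [Finset.mem_union, Finset.mem_inter]; tauto)
  have e4 : m₁ ∩ T ∩ (m₂ ∩ T) = m₁ ∩ m₂ ∩ T := by
    ext Q; simp only [Finset.mem_inter]; tauto
  have e5 : ((m₁ ∩ T ∪ m₂ ∩ T) ∩ (m₃ ∩ T)).card ≤ 1 + 1 := by
    refine (Finset.card_le_card (t := (m₁ ∩ m₃) ∪ (m₂ ∩ m₃)) ?_).trans
      ((Finset.card_union_le _ _).trans (add_le_add (H.card_inter_le_one h₁ h₃ h₁₃)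
        (H.card_inter_le_one h₂ h₃ h₂₃)))
    intro Q; simp only [Finset.mem_union, Finset.mem_inter]; tauto
  rw [e4] at e1
  omega

theorem three_lines' (H : HankelPlane q π S Λ) {m₁ m₂ m₃ T : Finset X} (h₁ : m₁ ∈ Λ) (h₂ : m₂ ∈ Λ)
    (h₃ : m₃ ∈ Λ) (h₁₂ : m₁ ≠ m₂) (h₁₃ : m₁ ≠ m₃) (h₂₃ : m₂ ≠ m₃) :
    (m₁ ∩ T).card + (m₂ ∩ T).card + (m₃ ∩ T).card ≤ T.card + 3 := by
  have h := H.three_lines (T := T) h₁ h₂ h₃ h₁₃ h₂₃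
  have : (m₁ ∩ m₂ ∩ T).card ≤ 1 :=
    (Finset.card_le_card Finset.inter_subset_left).trans (H.card_inter_le_one h₁ h₂ h₁₂)
  omega

theorem card_sdiff_line (H : HankelPlane q π S Λ) {g m : Finset X} (hg : g ∈ Λ) (hm : m ∈ Λ)
    (hgm : g ≠ m) : (g ∩ S).card ≤ ((g ∩ S) \ m).card + 1 := by
  have h1 := Finset.card_sdiff_add_card_inter (g ∩ S) m
  have h2 : (g ∩ S ∩ m).card ≤ 1 := (Finset.card_le_card (by
    intro Q; simp only [Finset.mem_inter]; tauto)).trans (H.card_inter_le_one hg hm hgm)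
  omega

theorem card_sdiff_line_le (H : HankelPlane q π S Λ) {g m : Finset X} (hg : g ∈ Λ) (hm : m ∈ Λ)
    (hgm : g ≠ m) : (g \ m).card = q := by
  obtain ⟨R, hR⟩ := H.meet g hg m hm hgm
  have h1 := Finset.card_sdiff_add_card_inter g m
  rw [hR, H.card_line g hg] at h1
  simpa using h1

theorem inter_sdiff_comm (g m T : Finset X) : (g ∩ T) \ m = g ∩ (T \ m) := by
  ext Q; simp only [Finset.mem_inter, Finset.mem_sdiff]; tauto

theorem hankel' (H : HankelPlane q π S Λ) {g m : Finset X} (hg : g ∈ Λ) (hm : m ∈ Λ) :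
    (g ∩ (S \ m)).card * (q + 1 - (g ∩ (S \ m)).card) ≤ (S \ m).card := by
  by_cases h : g = m
  · subst h
    have : g ∩ (S \ g) = ∅ := by
      ext Q; simp only [Finset.mem_inter, Finset.mem_sdiff, Finset.notMem_empty]; tauto
    simp [this]
  · rw [← inter_sdiff_comm]
    exact H.hankel g hg m hm h

theorem card_S_ge (H : HankelPlane q π S Λ) (hq : 2 ≤ q) (hS : S.Nonempty) : q + 1 ≤ S.card := by
  obtain ⟨P, hP⟩ := hS
  have key : ∀ m ∈ Λ, P ∉ m → q ≤ (S \ m).card := by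
    intro m hm hPm
    obtain ⟨g, hg, hPg, hgm⟩ := H.exists_line_ne (by omega) (H.S_sub hP) m
    have h := H.hankel g hg m hm hgm
    have h1 : 1 ≤ ((g ∩ S) \ m).card := Finset.card_pos.2 ⟨P, by simp [hP, hPg, hPm]⟩
    have h2 : ((g ∩ S) \ m).card ≤ q := by
      rw [← H.card_sdiff_line_le hg hm hgm]
      exact Finset.card_le_card (by intro Q; simp only [Finset.mem_inter, Finset.mem_sdiff]; tauto)
    set τ := ((g ∩ S) \ m).card
    obtain ⟨a, ha⟩ := Nat.exists_eq_add_of_le h1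
    obtain ⟨b, hb⟩ := Nat.exists_eq_add_of_le h2
    rw [show q + 1 - τ = b + 1 by omega, ha] at h
    nlinarith
  have hex : ∀ Q ∈ π, Q ≠ P → ∃ m ∈ Λ, Q ∈ m ∧ P ∉ m := by
    intro Q hQ hne
    obtain ⟨m, hm, hQm, h⟩ := H.exists_line_avoiding (by omega) hQ {P} (by simp; omega)
    exact ⟨m, hm, hQm, h P (by simp) hne.symm⟩
  have hπ : 1 < π.card := by rw [H.card_plane]; nlinarith
  obtain ⟨Q, hQ, hQP⟩ := Finset.exists_mem_ne hπ P
  obtain ⟨m, hm, -, hPm⟩ := hex Q hQ hQP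
  have h1 : 1 < S.card := by
    have := key m hm hPm
    have := Finset.card_le_card (Finset.sdiff_subset (s := S) (t := m))
    omega
  obtain ⟨Z, hZ, hZP⟩ := Finset.exists_mem_ne h1 P
  obtain ⟨m, hm, hZm, hPm⟩ := hex Z (H.S_sub hZ) hZP
  have h2 := key m hm hPm
  have h3 : (S \ m).card < S.card := Finset.card_lt_card (by
    rw [Finset.ssubset_iff_of_subset Finset.sdiff_subset]
    exact ⟨Z, hZ, by simp [hZm]⟩)
  omega

theorem cover_two (H : HankelPlane q π S Λ) (hq : 5 ≤ q) {l : Finset X} (hl : l ∈ Λ)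
    (ho : (S \ l).card < 3 * q - 6) :
    ∃ m₁ ∈ Λ, ∃ m₂ ∈ Λ, m₁ ≠ l ∧ m₂ ≠ l ∧ S \ l ⊆ m₁ ∪ m₂ ∧
      (m₁ = m₂ ∨ (q - 1 ≤ (m₁ ∩ (S \ l)).card ∧ q - 1 ≤ (m₂ ∩ (S \ l)).card)) := by
  have hdich : ∀ g ∈ Λ, (g ∩ (S \ l)).card ≤ 2 ∨ q - 1 ≤ (g ∩ (S \ l)).card := by
    intro g hg
    by_contra! h
    have h1 := H.hankel' hg hl
    set τ := (g ∩ (S \ l)).card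
    obtain ⟨a, ha⟩ := Nat.exists_eq_add_of_le (show 3 ≤ τ by omega)
    obtain ⟨b, hb⟩ := Nat.exists_eq_add_of_le (show τ + 2 ≤ q by omega)
    rw [show q + 1 - τ = b + 3 by omega, ha] at h1
    have : 3 * q - 6 = 3 * a + 3 * b + 9 := by omega
    nlinarith
  have hbig : ∀ Y ∈ S \ l, ∃ g ∈ Λ, Y ∈ g ∧ q - 1 ≤ (g ∩ (S \ l)).card := by
    intro Y hY
    by_contra! hcon
    have hYπ : Y ∈ π := H.S_sub (Finset.mem_sdiff.1 hY).1
    have hsm : ∀ g ∈ Λ, Y ∈ g → (g ∩ (S \ l)).card ≤ 1 + 1 := by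
      intro g hg hYg
      have := hdich g hg
      have := hcon g hg hYg
      omega
    have h1 := H.card_le_of_pencil (by omega) (Finset.sdiff_subset.trans H.S_sub) hY hsm
    have h2 : ∃ g ∈ Λ, Y ∈ g ∧ ((S \ l).card = 1 ∨ 2 ≤ (g ∩ (S \ l)).card) := by
      by_cases h : ∃ Z ∈ S \ l, Z ≠ Y
      · obtain ⟨Z, hZ, hZY⟩ := h
        obtain ⟨g, hg, hYg, hZg⟩ := H.join Y hYπ Z (H.S_sub (Finset.mem_sdiff.1 hZ).1) hZY.symm
        refine ⟨g, hg, hYg, Or.inr ?_⟩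
        exact Finset.one_lt_card.2 ⟨Y, by simp [hYg, hY, -Finset.mem_sdiff], Z,
          by simp [hZg, hZ, -Finset.mem_sdiff], hZY.symm⟩
      · push Not at h
        obtain ⟨g, hg, hYg, -⟩ := H.exists_line_ne (by omega) hYπ ∅
        refine ⟨g, hg, hYg, Or.inl ?_⟩
        rw [Finset.card_eq_one]
        exact ⟨Y, Finset.eq_singleton_iff_unique_mem.2 ⟨hY, h⟩⟩
    obtain ⟨g, hg, hYg, h3⟩ := h2
    have h4 := H.hankel' hg hl
    have h5 : 1 ≤ (g ∩ (S \ l)).card :=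
      Finset.card_pos.2 ⟨Y, by simp [hYg, hY, -Finset.mem_sdiff]⟩
    have h6 := hsm g hg hYg
    have h7 : (g ∩ (S \ l)).card ≤ (S \ l).card := Finset.card_le_card Finset.inter_subset_right
    obtain h8 | h8 : (g ∩ (S \ l)).card = 1 ∨ (g ∩ (S \ l)).card = 2 := by omega
    · rw [h8] at h4; omega
    · rw [h8] at h4; omega
  have hne : ∀ g ∈ Λ, q - 1 ≤ (g ∩ (S \ l)).card → g ≠ l := by
    rintro g hg h rfl
    have : g ∩ (S \ g) = ∅ := by
      ext Q; simp only [Finset.mem_inter, Finset.mem_sdiff, Finset.notMem_empty]; tauto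
    rw [this] at h
    simp at h
    omega
  by_cases h1 : ∃ m₁ ∈ Λ, q - 1 ≤ (m₁ ∩ (S \ l)).card
  · obtain ⟨m₁, hm₁, hb₁⟩ := h1
    by_cases h2 : ∃ m₂ ∈ Λ, m₂ ≠ m₁ ∧ q - 1 ≤ (m₂ ∩ (S \ l)).card
    · obtain ⟨m₂, hm₂, h12, hb₂⟩ := h2
      refine ⟨m₁, hm₁, m₂, hm₂, hne _ hm₁ hb₁, hne _ hm₂ hb₂, ?_, Or.inr ⟨hb₁, hb₂⟩⟩
      intro Y hY
      obtain ⟨g, hg, hYg, hb⟩ := hbig Y hY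
      rw [Finset.mem_union]
      by_contra! hcon
      have h3 := H.three_lines' (T := S \ l) hm₁ hm₂ hg h12.symm
        (fun h => hcon.1 (h ▸ hYg)) (fun h => hcon.2 (h ▸ hYg))
      omega
    · push Not at h2
      refine ⟨m₁, hm₁, m₁, hm₁, hne _ hm₁ hb₁, hne _ hm₁ hb₁, ?_, Or.inl rfl⟩
      intro Y hY
      obtain ⟨g, hg, hYg, hb⟩ := hbig Y hY
      have : g = m₁ := by
        by_contra h
        have := h2 g hg h
        omega
      simp [← this, hYg]
  · push Not at h1
    obtain ⟨m, hm, hml⟩ := H.exists_other_line (by omega) hl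
    refine ⟨m, hm, m, hm, hml, hml, ?_, Or.inl rfl⟩
    intro Y hY
    obtain ⟨g, hg, _, hb⟩ := hbig Y hY
    have := h1 g hg
    omega

theorem off_ge_of_three_le (H : HankelPlane q π S Λ) (hq : 5 ≤ q) {l : Finset X} (hl : l ∈ Λ)
    (h3 : 3 ≤ (l ∩ S).card) (h4 : (l ∩ S).card ≤ q - 2) : 3 * q - 6 ≤ (S \ l).card := by
  by_contra! ho
  obtain ⟨m₁, hm₁, m₂, hm₂, hl₁, hl₂, hcov, -⟩ := H.cover_two hq hl ho
  have h1 := H.hankel l hl m₁ hm₁ hl₁.symm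
  have h2 := H.card_sdiff_line hl hm₁ hl₁.symm
  have h5 : ((l ∩ S) \ m₁).card ≤ (l ∩ S).card := Finset.card_le_card Finset.sdiff_subset
  have h6 : (S \ m₁).card ≤ ((l ∩ S) \ m₁).card + q := by
    rw [← H.card_sdiff_line_le hm₂ hl hl₂]
    refine (Finset.card_le_card ?_).trans (Finset.card_union_le _ _)
    intro Y hY
    have := @hcov Y
    simp only [Finset.mem_union, Finset.mem_inter, Finset.mem_sdiff] at this hY ⊢
    tauto
  set τ := ((l ∩ S) \ m₁).card
  obtain ⟨a, ha⟩ := Nat.exists_eq_add_of_le (show 2 ≤ τ by omega)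
  obtain ⟨b, hb⟩ := Nat.exists_eq_add_of_le (show τ + 2 ≤ q by omega)
  rw [show q + 1 - τ = b + 3 by omega, ha] at h1
  have : q = a + b + 4 := by omega
  nlinarith

theorem off_ge_of_eq_sub_one (H : HankelPlane q π S Λ) (hq : 5 ≤ q) {l : Finset X} (hl : l ∈ Λ)
    (hno : ∀ g ∈ Λ, (g ∩ S).card ≤ 2 ∨ q - 1 ≤ (g ∩ S).card)
    (h3 : (l ∩ S).card = q - 1) : 3 * q - 6 ≤ (S \ l).card := by
  by_contra! ho
  obtain ⟨m₁, hm₁, m₂, hm₂, hl₁, hl₂, hcov, hor⟩ := H.cover_two hq hl ho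
  by_cases h12 : m₁ = m₂
  · have h1 := H.hankel l hl m₁ hm₁ hl₁.symm
    have h2 := H.card_sdiff_line hl hm₁ hl₁.symm
    have h5 : ((l ∩ S) \ m₁).card ≤ (l ∩ S).card := Finset.card_le_card Finset.sdiff_subset
    have h6 : (S \ m₁).card ≤ ((l ∩ S) \ m₁).card := by
      refine Finset.card_le_card ?_
      intro Y hY
      have := @hcov Y
      rw [← h12] at this
      simp only [Finset.mem_union, Finset.mem_inter, Finset.mem_sdiff] at this hY ⊢
      tauto
    set τ := ((l ∩ S) \ m₁).card
    have h7 : τ * 2 ≤ τ :=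
      (Nat.mul_le_mul_left τ (show 2 ≤ q + 1 - τ by omega)).trans (h1.trans h6)
    omega
  · obtain ⟨hb₁, hb₂⟩ := hor.resolve_left h12
    obtain ⟨Q₁, hQ₁, hQ₁'⟩ := H.exists_meet hl hm₁ hl₁.symm
    obtain ⟨Q₂, hQ₂, hQ₂'⟩ := H.exists_meet hl hm₂ hl₂.symm
    obtain ⟨Z, hZ₁, hZ₂⟩ := H.exists_meet hm₁ hm₂ h12
    obtain ⟨P, hP, hPn⟩ := Finset.exists_mem_notMem_of_card_lt_card
      (s := ({Q₁, Q₂} : Finset X)) (t := l ∩ S)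
      (lt_of_le_of_lt Finset.card_le_two (by omega))
    rw [Finset.mem_inter] at hP
    simp only [Finset.mem_insert, Finset.mem_singleton, not_or] at hPn
    have hP₁ : P ∉ m₁ := fun h => hPn.1 (H.eq_point hl hm₁ hl₁.symm hP.1 hQ₁ h hQ₁')
    have hP₂ : P ∉ m₂ := fun h => hPn.2 (H.eq_point hl hm₂ hl₂.symm hP.1 hQ₂ h hQ₂')
    have hsmall : ∀ m ∈ Λ, q - 1 ≤ (m ∩ (S \ l)).card → (m \ (S \ l)).card ≤ 2 := by
      intro m hm hb
      have := Finset.card_sdiff_add_card_inter m (S \ l)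
      rw [H.card_line m hm] at this
      omega
    obtain ⟨g, hg, hPg, hav⟩ := H.exists_line_avoiding (by omega) (H.S_sub hP.2)
      (insert Z (m₁ \ (S \ l) ∪ m₂ \ (S \ l))) (by
        refine (Finset.card_insert_le _ _).trans ?_
        have := Finset.card_union_le (m₁ \ (S \ l)) (m₂ \ (S \ l))
        have := hsmall m₁ hm₁ hb₁
        have := hsmall m₂ hm₂ hb₂
        omega)
    have hg₁ : g ≠ m₁ := fun h => hP₁ (h ▸ hPg)
    have hg₂ : g ≠ m₂ := fun h => hP₂ (h ▸ hPg)
    obtain ⟨Y₁, hY₁g, hY₁⟩ := H.exists_meet hg hm₁ hg₁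
    obtain ⟨Y₂, hY₂g, hY₂⟩ := H.exists_meet hg hm₂ hg₂
    have hPY₁ : Y₁ ≠ P := fun h => hP₁ (h ▸ hY₁)
    have hPY₂ : Y₂ ≠ P := fun h => hP₂ (h ▸ hY₂)
    have hS₁ : Y₁ ∈ S \ l := by
      by_contra h
      exact hav Y₁ (by simp [hY₁, h, -Finset.mem_sdiff, Finset.mem_sdiff (s := m₁)]) hPY₁ hY₁g
    have hS₂ : Y₂ ∈ S \ l := by
      by_contra h
      exact hav Y₂ (by simp [hY₂, h, -Finset.mem_sdiff, Finset.mem_sdiff (s := m₂)]) hPY₂ hY₂g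
    have hYY : Y₁ ≠ Y₂ := by
      intro h
      have : Y₁ = Z := H.eq_point hm₁ hm₂ h12 hY₁ hZ₁ (h ▸ hY₂) hZ₂
      exact hav Y₁ (by simp [this]) hPY₁ hY₁g
    rw [Finset.mem_sdiff] at hS₁ hS₂
    have hgl : g ≠ l := fun h => hS₁.2 (h ▸ hY₁g)
    have hge : 3 ≤ (g ∩ S).card := by
      have : ({P, Y₁, Y₂} : Finset X) ⊆ g ∩ S := by
        intro Q
        simp only [Finset.mem_insert, Finset.mem_singleton, Finset.mem_inter]
        rintro (rfl | rfl | rfl) <;> simp_all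
      have h := Finset.card_le_card this
      rwa [Finset.card_eq_three.2 ⟨P, Y₁, Y₂, hPY₁.symm, hPY₂.symm, hYY, rfl⟩] at h
    have hle : (g ∩ S).card ≤ 3 := by
      have : g ∩ S ⊆ {P, Y₁, Y₂} := by
        intro Q hQ
        rw [Finset.mem_inter] at hQ
        simp only [Finset.mem_insert, Finset.mem_singleton]
        by_cases hQl : Q ∈ l
        · exact Or.inl (H.eq_point hg hl hgl hQ.1 hPg hQl hP.1)
        · rcases Finset.mem_union.1 (hcov (Finset.mem_sdiff.2 ⟨hQ.2, hQl⟩)) with h | h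
          · exact Or.inr (Or.inl (H.eq_point hg hm₁ hg₁ hQ.1 hY₁g h hY₁))
          · exact Or.inr (Or.inr (H.eq_point hg hm₂ hg₂ hQ.1 hY₂g h hY₂))
      exact (Finset.card_le_card this).trans Finset.card_le_three
    have := hno g hg
    omega

theorem cover_one (H : HankelPlane q π S Λ) (hq : 3 ≤ q) {l : Finset X} (hl : l ∈ Λ)
    (ho : (S \ l).card < 2 * (q - 1)) : ∃ m ∈ Λ, m ≠ l ∧ S \ l ⊆ m := by
  have hdich : ∀ g ∈ Λ, (g ∩ (S \ l)).card ≤ 1 ∨ q ≤ (g ∩ (S \ l)).card := by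
    intro g hg
    by_contra! h
    have h1 := H.hankel' hg hl
    set τ := (g ∩ (S \ l)).card
    obtain ⟨a, ha⟩ := Nat.exists_eq_add_of_le (show 2 ≤ τ by omega)
    obtain ⟨b, hb⟩ := Nat.exists_eq_add_of_le (show τ + 1 ≤ q by omega)
    rw [show q + 1 - τ = b + 2 by omega, ha] at h1
    have : 2 * (q - 1) = 2 * a + 2 * b + 4 := by omega
    nlinarith
  by_cases h0 : S \ l = ∅
  · obtain ⟨m, hm, hml⟩ := H.exists_other_line (by omega) hl
    exact ⟨m, hm, hml, by simp [h0]⟩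
  obtain ⟨Y, hY⟩ := Finset.nonempty_iff_ne_empty.2 h0
  have hin : ∀ {Z}, Z ∈ S \ l → Z ∈ π := fun h => H.S_sub (Finset.mem_sdiff.1 h).1
  by_cases h1 : ∃ g ∈ Λ, q ≤ (g ∩ (S \ l)).card
  · obtain ⟨g, hg, hgb⟩ := h1
    refine ⟨g, hg, ?_, ?_⟩
    · rintro rfl
      have : g ∩ (S \ g) = ∅ := by
        ext Q; simp only [Finset.mem_inter, Finset.mem_sdiff, Finset.notMem_empty]; tauto
      rw [this] at hgb
      simp at hgb
      omega
    · intro Z hZ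
      by_contra hZg
      obtain ⟨R, hR⟩ : (g ∩ (S \ l)).Nonempty := Finset.card_pos.1 (by omega)
      rw [Finset.mem_inter] at hR
      have hZR : Z ≠ R := fun h => hZg (h ▸ hR.1)
      obtain ⟨f, hf, hZf, hRf⟩ := H.join Z (hin hZ) R (hin hR.2) hZR
      have h2 : 1 < (f ∩ (S \ l)).card := Finset.one_lt_card.2
        ⟨Z, Finset.mem_inter.2 ⟨hZf, hZ⟩, R, Finset.mem_inter.2 ⟨hRf, hR.2⟩, hZR⟩
      have h3 := hdich f hf
      have h4 := H.two_lines (T := S \ l) hf hg (fun h => hZg (h ▸ hZf))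
      omega
  · push Not at h1
    obtain ⟨g, hg, hYg, -⟩ := H.exists_line_ne (by omega) (hin hY) ∅
    have h2 := H.card_le_of_pencil (by omega) (Finset.sdiff_subset.trans H.S_sub) hY (k := 0)
      (by
        intro f hf _
        have := hdich f hf
        have := h1 f hf
        omega)
    have h3 : 1 ≤ (g ∩ (S \ l)).card := Finset.card_pos.2 ⟨Y, Finset.mem_inter.2 ⟨hYg, hY⟩⟩
    have h4 := H.hankel' hg hl
    have h5 : (g ∩ (S \ l)).card ≤ (S \ l).card := Finset.card_le_card Finset.inter_subset_right
    have h6 : (g ∩ (S \ l)).card = 1 := by omega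
    rw [h6] at h4
    omega

theorem off_ge_of_two_le (H : HankelPlane q π S Λ) (hq : 3 ≤ q) {l : Finset X} (hl : l ∈ Λ)
    (h3 : 2 ≤ (l ∩ S).card) (h4 : (l ∩ S).card ≤ q - 1) : 2 * (q - 1) ≤ (S \ l).card := by
  by_contra! ho
  obtain ⟨m, hm, hml, hcov⟩ := H.cover_one hq hl ho
  have h1 := H.hankel l hl m hm hml.symm
  have h2 := H.card_sdiff_line hl hm hml.symm
  have h5 : ((l ∩ S) \ m).card ≤ (l ∩ S).card := Finset.card_le_card Finset.sdiff_subset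
  have h6 : (S \ m).card ≤ ((l ∩ S) \ m).card := by
    refine Finset.card_le_card ?_
    intro Y hY
    have := @hcov Y
    simp only [Finset.mem_inter, Finset.mem_sdiff] at this hY ⊢
    tauto
  set τ := ((l ∩ S) \ m).card
  have h7 : τ * 2 ≤ τ :=
    (Nat.mul_le_mul_left τ (show 2 ≤ q + 1 - τ by omega)).trans (h1.trans h6)
  omega

end HankelPlane
end Plane

section Plane

namespace HankelPlane

variable {X : Type*} {q : ℕ} {π S : Finset X} {Λ : Finset (Finset X)}

theorem exists_long_line (H : HankelPlane q π S Λ) (hq : 3 ≤ q)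
    (hs : ∀ g ∈ Λ, (g ∩ S).card ≤ 2 ∨ q ≤ (g ∩ S).card)
    (hs3 : q = 3 → ∀ g ∈ Λ, (g ∩ S).card ≠ 2) {P : X} (hP : P ∈ S) :
    ∃ g ∈ Λ, P ∈ g ∧ q ≤ (g ∩ S).card := by
  by_contra! hcon
  have hPπ := H.S_sub hP
  have hsm : ∀ g ∈ Λ, P ∈ g → (g ∩ S).card ≤ 2 := by
    intro g hg hPg
    have := hs g hg
    have := hcon g hg hPg
    omega
  have h2 : ∃ g ∈ Λ, P ∈ g ∧ (g ∩ S).card = 2 := by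
    have h1 : 1 < S.card := by
      have := H.card_S_ge (by omega) ⟨P, hP⟩
      omega
    obtain ⟨Z, hZ, hZP⟩ := Finset.exists_mem_ne h1 P
    obtain ⟨g, hg, hPg, hZg⟩ := H.join P hPπ Z (H.S_sub hZ) hZP.symm
    refine ⟨g, hg, hPg, le_antisymm (hsm g hg hPg) ?_⟩
    exact Finset.one_lt_card.2 ⟨P, Finset.mem_inter.2 ⟨hPg, hP⟩, Z, Finset.mem_inter.2 ⟨hZg, hZ⟩,
      hZP.symm⟩
  obtain ⟨g, hg, hPg, hg2⟩ := h2
  have hq4 : 4 ≤ q := by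
    by_contra h
    exact hs3 (by omega) g hg hg2
  obtain ⟨R, hRg, hRS⟩ : ∃ R ∈ g, R ∉ g ∩ S :=
    Finset.exists_mem_notMem_of_card_lt_card (by rw [hg2, H.card_line g hg]; omega)
  have hRS : R ∉ S := fun h => hRS (Finset.mem_inter.2 ⟨hRg, h⟩)
  have hRπ := H.sub g hg hRg
  have hcard := H.card_le_of_pencil (by omega) H.S_sub hP (k := 1) hsm
  have hex : ∃ m ∈ Λ, R ∈ m ∧ m ≠ g ∧ (S \ m).card < 2 * (q - 1) := by
    by_cases hSg : S ⊆ g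
    · obtain ⟨m, hm, hRm, hmg⟩ := H.exists_line_ne (by omega) hRπ g
      refine ⟨m, hm, hRm, hmg, ?_⟩
      have h5 : (S \ m).card ≤ (g ∩ S).card := Finset.card_le_card (by
        intro Q hQ
        have := @hSg Q
        simp only [Finset.mem_inter, Finset.mem_sdiff] at hQ ⊢
        tauto)
      omega
    · obtain ⟨Y, hY, hYg⟩ := Finset.not_subset.1 hSg
      obtain ⟨m, hm, hRm, hYm⟩ := H.join R hRπ Y (H.S_sub hY) (fun h => hRS (h ▸ hY))
      refine ⟨m, hm, hRm, fun h => hYg (h ▸ hYm), ?_⟩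
      have h3 : (S \ m).card < S.card := Finset.card_lt_card (by
        rw [Finset.ssubset_iff_of_subset Finset.sdiff_subset]
        exact ⟨Y, hY, by simp [hYm]⟩)
      omega
  obtain ⟨m, hm, hRm, hmg, hlt⟩ := hex
  have h1 := H.hankel g hg m hm hmg.symm
  have h2 : (g ∩ S) \ m = g ∩ S := by
    rw [Finset.sdiff_eq_self_iff_disjoint, Finset.disjoint_left]
    intro Q hQ hQm
    rw [Finset.mem_inter] at hQ
    have : Q = R := H.eq_point hg hm hmg.symm hQ.1 hRg hQm hRm
    exact hRS (this ▸ hQ.2)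
  rw [h2, hg2] at h1
  omega

theorem off_ge_of_forall_long (H : HankelPlane q π S Λ) (hq : 3 ≤ q) {l : Finset X} (hl : l ∈ Λ)
    (hls : q ≤ (l ∩ S).card)
    (hlong : ∀ P ∈ l, P ∈ S → ∃ g ∈ Λ, g ≠ l ∧ P ∈ g ∧ q ≤ (g ∩ S).card) :
    3 * q - 6 ≤ (S \ l).card := by
  obtain ⟨P₁, h1, P₂, h2, P₃, h3, h12, h13, h23⟩ :=
    Finset.two_lt_card.1 (show 2 < (l ∩ S).card by omega)
  rw [Finset.mem_inter] at h1 h2 h3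
  obtain ⟨g₁, hg₁, hl₁, hP₁, hs₁⟩ := hlong P₁ h1.1 h1.2
  obtain ⟨g₂, hg₂, hl₂, hP₂, hs₂⟩ := hlong P₂ h2.1 h2.2
  obtain ⟨g₃, hg₃, hl₃, hP₃, hs₃⟩ := hlong P₃ h3.1 h3.2
  have k := H.three_lines' (T := S \ l) hg₁ hg₂ hg₃
    (fun h => h12 (H.eq_point hl hg₁ hl₁.symm h1.1 h2.1 hP₁ (h ▸ hP₂)))
    (fun h => h13 (H.eq_point hl hg₁ hl₁.symm h1.1 h3.1 hP₁ (h ▸ hP₃)))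
    (fun h => h23 (H.eq_point hl hg₂ hl₂.symm h2.1 h3.1 hP₂ (h ▸ hP₃)))
  have k1 := H.card_sdiff_line hg₁ hl hl₁
  have k2 := H.card_sdiff_line hg₂ hl hl₂
  have k3 := H.card_sdiff_line hg₃ hl hl₃
  rw [inter_sdiff_comm] at k1 k2 k3
  omega

section Values

variable {R : Type*} [Field R] {c : X → R} {κ : R}

theorem add_eq_of_sum {g : Finset X} (hκ : ∑ P ∈ g, c P = κ) {A B : X} (hA : A ∈ g) (hB : B ∈ g)
    (hAB : A ≠ B) (h : ∀ Q ∈ g, Q ≠ A → Q ≠ B → c Q = 0) : c A + c B = κ := by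
  rw [← hκ, ← Finset.sum_pair hAB]
  refine Finset.sum_subset ?_ ?_
  · intro Q; simp only [Finset.mem_insert, Finset.mem_singleton]; rintro (rfl | rfl) <;> assumption
  · intro Q hQ hn
    simp only [Finset.mem_insert, Finset.mem_singleton, not_or] at hn
    exact h Q hQ hn.1 hn.2

theorem add_eq_of_short {g : Finset X} (hκ : ∑ P ∈ g, c P = κ)
    (hc : ∀ P ∈ g, P ∈ S ↔ c P ≠ 0) {A B : X} (hA : A ∈ g) (hB : B ∈ g)
    (hAB : A ≠ B) (hcA : c A ≠ 0) (hcB : c B ≠ 0) (hs : (g ∩ S).card ≤ 2) : c A + c B = κ := by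
  refine add_eq_of_sum hκ hA hB hAB fun Q hQ hQA hQB => ?_
  by_contra hcQ
  have : ({Q, A, B} : Finset X) ⊆ g ∩ S := by
    intro Y
    simp only [Finset.mem_insert, Finset.mem_singleton, Finset.mem_inter]
    rintro (rfl | rfl | rfl)
    · exact ⟨hQ, (hc _ hQ).2 hcQ⟩
    · exact ⟨hA, (hc _ hA).2 hcA⟩
    · exact ⟨hB, (hc _ hB).2 hcB⟩
  have h := Finset.card_le_card this
  rw [Finset.card_eq_three.2 ⟨Q, A, B, hQA, hQB, hAB, rfl⟩] at h
  omega

theorem exists_const_of_unique_long (H : HankelPlane q π S Λ) (hq : 3 ≤ q)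
    (hs : ∀ g ∈ Λ, (g ∩ S).card ≤ 2 ∨ q ≤ (g ∩ S).card)
    (hs3 : q = 3 → ∀ g ∈ Λ, (g ∩ S).card ≠ 2)
    (hc : ∀ P ∈ π, P ∈ S ↔ c P ≠ 0) (hκ : ∀ g ∈ Λ, ∑ P ∈ g, c P = κ)
    {l : Finset X} (hl : l ∈ Λ) {P : X} (hPl : P ∈ l) (hP : P ∈ S)
    (hun : ∀ g ∈ Λ, g ≠ l → P ∈ g → (g ∩ S).card < q) :
    ∃ z ∈ l, ∃ a, ∀ Q ∈ l, Q ≠ z → c Q = a := by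
  have hPπ := H.S_sub hP
  have hoff : (S \ l).card ≤ q ∧ (q = 3 → S \ l = ∅) := by
    have h1 : S \ l ⊆ ((pencil Λ P).erase l).biUnion fun g => (g ∩ S) \ {P} := by
      intro Q hQ
      rw [Finset.mem_sdiff] at hQ
      have hPQ : P ≠ Q := fun h => hQ.2 (h ▸ hPl)
      obtain ⟨g, hg, hPg, hQg⟩ := H.join P hPπ Q (H.S_sub hQ.1) hPQ
      simp only [Finset.mem_biUnion, Finset.mem_erase, mem_pencil, Finset.mem_sdiff,
        Finset.mem_inter, Finset.mem_singleton]
      exact ⟨g, ⟨fun h => hQ.2 (h ▸ hQg), hg, hPg⟩, ⟨hQg, hQ.1⟩, hPQ.symm⟩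
    have h2 : ∀ g ∈ (pencil Λ P).erase l, ((g ∩ S) \ {P}).card + 1 = (g ∩ S).card ∧
        (g ∩ S).card ≤ 2 ∧ (q = 3 → (g ∩ S).card ≠ 2) := by
      intro g hg
      rw [Finset.mem_erase, mem_pencil] at hg
      have e1 := hs g hg.2.1
      have e2 := hun g hg.2.1 hg.1 hg.2.2
      have e3 := Finset.card_sdiff_add_card_inter (g ∩ S) {P}
      have e4 : g ∩ S ∩ {P} = {P} := by
        rw [Finset.inter_eq_right]
        simp [hg.2.2, hP]
      rw [e4, Finset.card_singleton] at e3
      exact ⟨e3, by omega, fun h => hs3 h g hg.2.1⟩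
    have h3 : ((pencil Λ P).erase l).card = q := by
      rw [Finset.card_erase_of_mem (mem_pencil.2 ⟨hl, hPl⟩), H.card_pencil (by omega) hPπ]
      simp
    constructor
    · refine (Finset.card_le_card h1).trans ((Finset.card_biUnion_le_card_mul _ _ 1 ?_).trans ?_)
      · intro g hg
        have := h2 g hg
        omega
      · rw [h3, mul_one]
    · intro hq3
      rw [← Finset.card_eq_zero, ← Nat.le_zero]
      refine (Finset.card_le_card h1).trans ((Finset.card_biUnion_le_card_mul _ _ 0 ?_).trans ?_)
      · intro g hg
        obtain ⟨e1, e2, e3⟩ := h2 g hg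
        have := e3 hq3
        omega
      · simp
  have hcov : ∃ m ∈ Λ, m ≠ l ∧ S \ l ⊆ m := by
    by_cases h0 : S \ l = ∅
    · obtain ⟨m, hm, hml⟩ := H.exists_other_line (by omega) hl
      exact ⟨m, hm, hml, by simp [h0]⟩
    · have hq4 : 4 ≤ q := by
        by_contra h
        exact h0 (hoff.2 (by omega))
      obtain ⟨Y, hY⟩ := Finset.nonempty_iff_ne_empty.2 h0
      rw [Finset.mem_sdiff] at hY
      obtain ⟨m, hm, hYm, hms⟩ := H.exists_long_line hq hs hs3 hY.1
      have hml : m ≠ l := fun h => hY.2 (h ▸ hYm)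
      refine ⟨m, hm, hml, ?_⟩
      intro Z hZ
      by_contra hZm
      rw [Finset.mem_sdiff] at hZ
      obtain ⟨f, hf, hZf, hfs⟩ := H.exists_long_line hq hs hs3 hZ.1
      have hfl : f ≠ l := fun h => hZ.2 (h ▸ hZf)
      have k1 := H.card_sdiff_line hm hl hml
      have k2 := H.card_sdiff_line hf hl hfl
      have k3 := H.two_lines (T := S \ l) hf hm (fun h => hZm (h ▸ hZf))
      rw [inter_sdiff_comm] at k1 k2
      omega
  obtain ⟨m, hm, hml, hcov⟩ := hcov
  obtain ⟨z, hzl, hzm⟩ := H.exists_meet hl hm hml.symm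
  obtain ⟨T, hTm, hTz⟩ : ∃ T ∈ m, T ≠ z :=
    Finset.exists_mem_ne (by rw [H.card_line m hm]; omega) z
  refine ⟨z, hzl, κ - c T, fun Q hQ hQz => ?_⟩
  have hTl : T ∉ l := fun h => hTz (H.eq_point hl hm hml.symm h hzl hTm hzm)
  have hQm : Q ∉ m := fun h => hQz (H.eq_point hl hm hml.symm hQ hzl h hzm)
  have hQT : Q ≠ T := fun h => hTl (h ▸ hQ)
  obtain ⟨g, hg, hQg, hTg⟩ := H.join Q (H.sub l hl hQ) T (H.sub m hm hTm) hQT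
  have := add_eq_of_sum (hκ g hg) hQg hTg hQT (by
    intro Y hY hYQ hYT
    by_contra hcY
    have hYS := (hc Y (H.sub g hg hY)).2 hcY
    by_cases hYl : Y ∈ l
    · exact hYQ (H.eq_point hg hl (fun h => hTl (h ▸ hTg)) hY hQg hYl hQ)
    · exact hYT (H.eq_point hg hm (fun h => hQm (h ▸ hQg)) hY hTg
        (hcov (Finset.mem_sdiff.2 ⟨hYS, hYl⟩)) hTm))
  rw [← this]; ring

theorem const_spec (hq : 3 ≤ q) (hqR : (q : R) = 0) {l : Finset X} (hcl : l.card = q + 1)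
    (hκ : ∑ P ∈ l, c P = κ) (hc : ∀ P ∈ l, P ∈ S ↔ c P ≠ 0) (hls : q ≤ (l ∩ S).card)
    {z : X} (hz : z ∈ l) {a : R} (ha : ∀ Q ∈ l, Q ≠ z → c Q = a) : c z = κ ∧ a ≠ 0 := by
  constructor
  · rw [← hκ, ← Finset.add_sum_erase _ _ hz, Finset.sum_congr rfl (g := fun _ => a)]
    · rw [Finset.sum_const, Finset.card_erase_of_mem hz, hcl]
      simp [hqR]
    · intro Q hQ
      rw [Finset.mem_erase] at hQ
      exact ha Q hQ.2 hQ.1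
  · rintro rfl
    have : l ∩ S ⊆ {z} := by
      intro Q hQ
      rw [Finset.mem_inter] at hQ
      rw [Finset.mem_singleton]
      by_contra h
      exact (hc Q hQ.1).1 hQ.2 (ha Q hQ.1 h)
    have := Finset.card_le_card this
    rw [Finset.card_singleton] at this
    omega

theorem long_of_two_long_of_ne_zero (H : HankelPlane q π S Λ) (hq : 3 ≤ q)
    (hs : ∀ g ∈ Λ, (g ∩ S).card ≤ 2 ∨ q ≤ (g ∩ S).card)
    (hc : ∀ P ∈ π, P ∈ S ↔ c P ≠ 0) (hκ : ∀ g ∈ Λ, ∑ P ∈ g, c P = κ)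
    (hsp : ∀ l ∈ Λ, q ≤ (l ∩ S).card → ∃ z ∈ l, c z = κ ∧ ∃ a, a ≠ 0 ∧ ∀ Q ∈ l, Q ≠ z → c Q = a)
    (hκ0 : κ ≠ 0) {P : X} (hPall : c P ≠ κ ∨ ∀ Q, c Q ≠ 0 → c Q = κ)
    {l₁ l₂ f : Finset X} (h₁ : l₁ ∈ Λ) (h₂ : l₂ ∈ Λ) (hf : f ∈ Λ) (h₁₂ : l₁ ≠ l₂)
    (hP₁ : P ∈ l₁) (hP₂ : P ∈ l₂) (hs₁ : q ≤ (l₁ ∩ S).card)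
    (hs₂ : q ≤ (l₂ ∩ S).card) : q ≤ (f ∩ S).card := by
  by_contra! hlt
  have hfull : ∀ l ∈ Λ, q ≤ (l ∩ S).card → ∀ Q ∈ l, c Q ≠ 0 := by
    intro l hl hls Q hQ
    obtain ⟨z, hz, hzκ, a, ha, hall⟩ := hsp l hl hls
    by_cases h : Q = z
    · rw [h, hzκ]; exact hκ0
    · rw [hall Q hQ h]; exact ha
  obtain ⟨t, htf, htS⟩ : ∃ t ∈ f, t ∉ f ∩ S :=
    Finset.exists_mem_notMem_of_card_lt_card (by rw [H.card_line f hf]; omega)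
  have ht0 : c t = 0 := by
    by_contra h
    exact htS (Finset.mem_inter.2 ⟨htf, (hc t (H.sub f hf htf)).2 h⟩)
  obtain ⟨Y, hY₁, hYP, hYκ⟩ : ∃ Y ∈ l₁, Y ≠ P ∧ c Y = κ := by
    rcases hPall with h | h
    · obtain ⟨z, hz, hzκ, -⟩ := hsp l₁ h₁ hs₁
      exact ⟨z, hz, fun e => h (e ▸ hzκ), hzκ⟩
    · obtain ⟨Y, hY, hYP⟩ := Finset.exists_mem_ne
        (show 1 < l₁.card by rw [H.card_line l₁ h₁]; omega) P
      exact ⟨Y, hY, hYP, h Y (hfull l₁ h₁ hs₁ Y hY)⟩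
  have htY : t ≠ Y := fun h => hκ0 (by rw [← hYκ, ← h, ht0])
  obtain ⟨g, hg, htg, hYg⟩ := H.join t (H.sub f hf htf) Y (H.sub l₁ h₁ hY₁) htY
  have hgs : (g ∩ S).card ≤ 2 := by
    rcases hs g hg with h | h
    · exact h
    · exact absurd ht0 (hfull g hg h t htg)
  have hg₂ : g ≠ l₂ := fun h => hfull l₂ h₂ hs₂ t (h ▸ htg) ht0
  obtain ⟨Q, hQg, hQ₂⟩ := H.exists_meet hg h₂ hg₂
  have hQY : Y ≠ Q := fun h => hYP (H.eq_point h₁ h₂ h₁₂ hY₁ hP₁ (h ▸ hQ₂) hP₂)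
  have hQ0 := hfull l₂ h₂ hs₂ Q hQ₂
  have := add_eq_of_short (hκ g hg) (fun P hP => hc P (H.sub g hg hP)) hYg hQg hQY
    (by rw [hYκ]; exact hκ0) hQ0 hgs
  rw [hYκ] at this
  exact hQ0 (by linear_combination this)

theorem long_of_two_long_of_zero (H : HankelPlane q π S Λ) (hq : 3 ≤ q)
    (hq2 : (2 : R) = 0 → q = 4 ∨ 8 ≤ q)
    (hs : ∀ g ∈ Λ, (g ∩ S).card ≤ 2 ∨ q ≤ (g ∩ S).card)
    (hs3 : q = 3 → ∀ g ∈ Λ, (g ∩ S).card ≠ 2)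
    (hc : ∀ P ∈ π, P ∈ S ↔ c P ≠ 0) (hκ : ∀ g ∈ Λ, ∑ P ∈ g, c P = 0)
    (hsp : ∀ l ∈ Λ, q ≤ (l ∩ S).card → ∃ z ∈ l, c z = 0 ∧ ∃ a, a ≠ 0 ∧ ∀ Q ∈ l, Q ≠ z → c Q = a)
    {P : X} (hP : P ∈ S)
    {l₁ l₂ f : Finset X} (h₁ : l₁ ∈ Λ) (h₂ : l₂ ∈ Λ) (hf : f ∈ Λ) (h₁₂ : l₁ ≠ l₂)
    (hP₁ : P ∈ l₁) (hP₂ : P ∈ l₂) (hPf : P ∈ f) (hs₁ : q ≤ (l₁ ∩ S).card)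
    (hs₂ : q ≤ (l₂ ∩ S).card) :
    q ≤ (f ∩ S).card ∨ (q = 4 ∧ (f ∩ S).card = 2 ∧ 7 ≤ (S \ f).card) := by
  by_contra! hcon
  obtain ⟨hlt, hcon⟩ := hcon
  have hPπ := H.S_sub hP
  have hcP : c P ≠ 0 := (hc P hPπ).1 hP
  have hfs : (f ∩ S).card ≤ 2 := by
    have := hs f hf
    omega
  -- the second point of `S` on `f`
  obtain ⟨P', hP'f, hP'P, hcP'⟩ : ∃ P' ∈ f, P' ≠ P ∧ c P' ≠ 0 := by
    by_contra! h
    have e := Finset.sum_eq_single_of_mem P hPf h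
    rw [hκ f hf] at e
    exact hcP e.symm
  have hsum : c P + c P' = 0 := add_eq_of_short (hκ f hf) (fun P hP => hc P (H.sub f hf hP))
    hPf hP'f hP'P.symm hcP hcP' hfs
  have hP'S : P' ∈ S := (hc P' (H.sub f hf hP'f)).2 hcP'
  have hf2 : (f ∩ S).card = 2 := le_antisymm hfs (Finset.one_lt_card.2
    ⟨P, Finset.mem_inter.2 ⟨hPf, hP⟩, P', Finset.mem_inter.2 ⟨hP'f, hP'S⟩, hP'P.symm⟩)
  have hq4 : 4 ≤ q := by
    by_contra h
    exact hs3 (by omega) f hf hf2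
  obtain ⟨l₃, h₃, hP₃, hs₃⟩ := H.exists_long_line hq hs hs3 hP'S
  have hne : ∀ l, q ≤ (l ∩ S).card → l ≠ f := by
    rintro l hl rfl
    omega
  have hf₁ := hne l₁ hs₁
  have hf₂ := hne l₂ hs₂
  have hf₃ := hne l₃ hs₃
  have hval : ∀ l ∈ Λ, q ≤ (l ∩ S).card → ∀ A ∈ l, c A ≠ 0 →
      ∃ z ∈ l, c z = 0 ∧ ∀ Q ∈ l, Q ≠ z → c Q = c A := by
    intro l hl hls A hA hcA
    obtain ⟨z, hz, hz0, a, ha, hall⟩ := hsp l hl hls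
    refine ⟨z, hz, hz0, fun Q hQ hQz => ?_⟩
    rw [hall Q hQ hQz, hall A hA (fun h => hcA (h ▸ hz0))]
  have huniq : ∀ l ∈ Λ, q ≤ (l ∩ S).card → ∀ A ∈ l, ∀ B ∈ l, c A = 0 → c B = 0 → A = B := by
    intro l hl hls A hA B hB hcA hcB
    obtain ⟨z, hz, hz0, a, ha, hall⟩ := hsp l hl hls
    have : ∀ Q ∈ l, c Q = 0 → Q = z := fun Q hQ hQ0 => by
      by_contra h
      exact ha (by rw [← hall Q hQ h, hQ0])
    rw [this A hA hcA, this B hB hcB]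
  obtain ⟨z₁, hz₁, hz₁0, hv₁⟩ := hval l₁ h₁ hs₁ P hP₁ hcP
  obtain ⟨z₂, hz₂, hz₂0, hv₂⟩ := hval l₂ h₂ hs₂ P hP₂ hcP
  obtain ⟨z₃, hz₃, hz₃0, hv₃⟩ := hval l₃ h₃ hs₃ P' hP₃ hcP'
  have hP'₁ : P' ∉ l₁ := fun h => hP'P (H.eq_point h₁ hf hf₁ h hP₁ hP'f hPf)
  have hP'₂ : P' ∉ l₂ := fun h => hP'P (H.eq_point h₂ hf hf₂ h hP₂ hP'f hPf)
  have h₁₃ : l₁ ≠ l₃ := fun h => hP'₁ (h ▸ hP₃)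
  have h₂₃ : l₂ ≠ l₃ := fun h => hP'₂ (h ▸ hP₃)
  obtain ⟨Y₁, hY₁, hY₁₃⟩ := H.exists_meet h₁ h₃ h₁₃
  obtain ⟨Y₂, hY₂, hY₂₃⟩ := H.exists_meet h₂ h₃ h₂₃
  by_cases h2 : (2 : R) = 0
  · rcases hq2 h2 with h4 | h8
    · have k := H.three_lines (T := S \ f) h₁ h₂ h₃ h₁₃ h₂₃
      have k0 : l₁ ∩ l₂ ∩ (S \ f) = ∅ := by
        rw [Finset.eq_empty_iff_forall_notMem]
        intro Q hQ
        simp only [Finset.mem_inter, Finset.mem_sdiff] at hQ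
        exact hQ.2.2 (H.eq_point h₁ h₂ h₁₂ hQ.1.1 hP₁ hQ.1.2 hP₂ ▸ hPf)
      have k1 := H.card_sdiff_line h₁ hf hf₁
      have k2 := H.card_sdiff_line h₂ hf hf₂
      have k3 := H.card_sdiff_line h₃ hf hf₃
      rw [inter_sdiff_comm] at k1 k2 k3
      rw [k0, Finset.card_empty] at k
      have := hcon h4 hf2
      omega
    · obtain ⟨t, t', ht, ht', htt⟩ : ∃ t t', t ∈ f \ S ∧ t' ∈ f \ S ∧ t ≠ t' := by
        have e := Finset.card_sdiff_add_card_inter f S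
        rw [H.card_line f hf] at e
        obtain ⟨a, ha, b, hb, hab⟩ := Finset.one_lt_card.1 (show 1 < (f \ S).card by omega)
        exact ⟨a, b, ha, hb, hab⟩
      rw [Finset.mem_sdiff] at ht ht'
      have hzero : ∀ {Q}, Q ∈ π → Q ∉ S → c Q = 0 := fun h h' => by
        by_contra h0
        exact h' ((hc _ h).2 h0)
      have ht0 := hzero (H.sub f hf ht.1) ht.2
      have ht'0 := hzero (H.sub f hf ht'.1) ht'.2
      have hz₁f : z₁ ∉ f := fun h => hcP (H.eq_point h₁ hf hf₁ hz₁ hP₁ h hPf ▸ hz₁0)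
      have htz : t ≠ z₁ := fun h => hz₁f (h ▸ ht.1)
      obtain ⟨h, hh, hth, hzh⟩ := H.join t (H.sub f hf ht.1) z₁ (H.sub l₁ h₁ hz₁) htz
      have hhs : (h ∩ S).card ≤ 2 := by
        rcases hs h hh with e | e
        · exact e
        · exact absurd (huniq h hh e t hth z₁ hzh ht0 hz₁0) htz
      have hhf : h ≠ f := fun e => hz₁f (e ▸ hzh)
      have ht'h : t' ∉ h := fun e => htt (H.eq_point hh hf hhf hth e ht.1 ht'.1)
      obtain ⟨g, hg, ht'g, hav⟩ := H.exists_line_avoiding (by omega) (H.sub f hf ht'.1)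
        (({P, z₁, z₂, z₃, Y₁, Y₂} : Finset X) ∪ (h ∩ S))
        ((Finset.card_union_le _ _).trans (by
          have : ({P, z₁, z₂, z₃, Y₁, Y₂} : Finset X).card ≤ 6 := Finset.card_le_six
          omega))
      have ht'n : ∀ l ∈ Λ, l ≠ f → ∀ A ∈ l, A ∈ f → c A ≠ 0 → t' ∉ l := by
        intro l hl hlf A hA hAf hcA ht'l
        exact hcA (H.eq_point hl hf hlf hA ht'l hAf ht'.1 ▸ ht'0)
      have ht'₁ := ht'n l₁ h₁ hf₁ P hP₁ hPf hcP
      have ht'₂ := ht'n l₂ h₂ hf₂ P hP₂ hPf hcP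
      have ht'₃ := ht'n l₃ h₃ hf₃ P' hP₃ hP'f hcP'
      have hg₁ : g ≠ l₁ := fun e => ht'₁ (e ▸ ht'g)
      have hg₂ : g ≠ l₂ := fun e => ht'₂ (e ▸ ht'g)
      have hg₃ : g ≠ l₃ := fun e => ht'₃ (e ▸ ht'g)
      obtain ⟨A₁, hA₁g, hA₁⟩ := H.exists_meet hg h₁ hg₁
      obtain ⟨A₂, hA₂g, hA₂⟩ := H.exists_meet hg h₂ hg₂
      obtain ⟨A₃, hA₃g, hA₃⟩ := H.exists_meet hg h₃ hg₃
      have nA₁ : A₁ ≠ t' := fun e => ht'₁ (e ▸ hA₁)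
      have nA₂ : A₂ ≠ t' := fun e => ht'₂ (e ▸ hA₂)
      have nA₃ : A₃ ≠ t' := fun e => ht'₃ (e ▸ hA₃)
      have hne' : ∀ A ∈ g, A ≠ t' → ∀ B ∈ ({P, z₁, z₂, z₃, Y₁, Y₂} : Finset X), A ≠ B := by
        rintro A hA hAt B hB rfl
        exact hav A (Finset.mem_union_left _ hB) hAt hA
      have c₁ : c A₁ ≠ 0 := by rw [hv₁ A₁ hA₁ (hne' A₁ hA₁g nA₁ z₁ (by simp))]; exact hcP
      have c₂ : c A₂ ≠ 0 := by rw [hv₂ A₂ hA₂ (hne' A₂ hA₂g nA₂ z₂ (by simp))]; exact hcP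
      have c₃ : c A₃ ≠ 0 := by rw [hv₃ A₃ hA₃ (hne' A₃ hA₃g nA₃ z₃ (by simp))]; exact hcP'
      have n₁₂ : A₁ ≠ A₂ := fun e => hne' A₁ hA₁g nA₁ P (by simp)
        (H.eq_point h₁ h₂ h₁₂ hA₁ hP₁ (e ▸ hA₂) hP₂)
      have n₁₃ : A₁ ≠ A₃ := fun e => hne' A₁ hA₁g nA₁ Y₁ (by simp)
        (H.eq_point h₁ h₃ h₁₃ hA₁ hY₁ (e ▸ hA₃) hY₁₃)
      have n₂₃ : A₂ ≠ A₃ := fun e => hne' A₂ hA₂g nA₂ Y₂ (by simp)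
        (H.eq_point h₂ h₃ h₂₃ hA₂ hY₂ (e ▸ hA₃) hY₂₃)
      have hin : ∀ {Q}, Q ∈ g → c Q ≠ 0 → Q ∈ g ∩ S := fun h h' =>
        Finset.mem_inter.2 ⟨h, (hc _ (H.sub g hg h)).2 h'⟩
      have hgs : q ≤ (g ∩ S).card := by
        have := Finset.two_lt_card.2 ⟨A₁, hin hA₁g c₁, A₂, hin hA₂g c₂, A₃, hin hA₃g c₃,
          n₁₂, n₁₃, n₂₃⟩
        have := hs g hg
        omega
      obtain ⟨Z, hZg, hZh⟩ := H.exists_meet hg hh (fun e => ht'h (e ▸ ht'g))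
      have hZt : Z ≠ t' := fun e => ht'h (e ▸ hZh)
      have hZS : Z ∉ S := fun e =>
        hav Z (Finset.mem_union_right _ (Finset.mem_inter.2 ⟨hZh, e⟩)) hZt hZg
      exact hZt (huniq g hg hgs Z hZg t' ht'g (hzero (H.sub g hg hZg) hZS) ht'0)
  · have hdiff : c P ≠ c P' := by
      intro e
      rw [← e] at hsum
      have : (2 : R) * c P = 0 := by linear_combination hsum
      rcases mul_eq_zero.1 this with h | h
      · exact h2 h
      · exact hcP h
    have key : ∀ l ∈ Λ, q ≤ (l ∩ S).card → ∀ z ∈ l, c z = 0 → (∀ Q ∈ l, Q ≠ z → c Q = c P) →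
        ∀ Y ∈ l, Y ∈ l₃ → Y = z ∧ Y = z₃ := by
      intro l hl hls z hz hz0 hv Y hY hY₃
      have hY0 : c Y = 0 := by
        by_contra h0
        have e1 := hv Y hY (fun e => h0 (e ▸ hz0))
        have e2 := hv₃ Y hY₃ (fun e => h0 (e ▸ hz₃0))
        exact hdiff (e1.symm.trans e2)
      exact ⟨huniq l hl hls Y hY z hz hY0 hz0, huniq l₃ h₃ hs₃ Y hY₃ z₃ hz₃ hY0 hz₃0⟩
    obtain ⟨e1, e2⟩ := key l₁ h₁ hs₁ z₁ hz₁ hz₁0 hv₁ Y₁ hY₁ hY₁₃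
    obtain ⟨e3, e4⟩ := key l₂ h₂ hs₂ z₂ hz₂ hz₂0 hv₂ Y₂ hY₂ hY₂₃
    have e5 : Y₁ = P := H.eq_point h₁ h₂ h₁₂ hY₁ hP₁ ((e2.trans e4.symm) ▸ hY₂) hP₂
    exact hcP (by rw [← e5, e1, hz₁0])

end Values

end HankelPlane
end Plane

section ProjPts

open Module

variable {V : Type*} [AddCommGroup V] [Module F V]

theorem finrank_comap_of_surjective {W : Type*} [AddCommGroup W] [Module F W]
    [FiniteDimensional F V] (f : V →ₗ[F] W) (hf : Function.Surjective f) (U : Submodule F W) :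
    finrank F (U.comap f) = finrank F U + finrank F (LinearMap.ker f) := by
  have h := LinearMap.finrank_range_add_finrank_ker (f.domRestrict (U.comap f))
  have hr : LinearMap.range (f.domRestrict (U.comap f)) = U := by
    rw [LinearMap.range_domRestrict, Submodule.map_comap_eq_of_surjective hf]
  have hk : finrank F (LinearMap.ker (f.domRestrict (U.comap f))) =
      finrank F (LinearMap.ker f) := by
    rw [LinearMap.ker_domRestrict]
    exact (Submodule.comapSubtypeEquivOfLe
      (LinearMap.ker_le_comap (f := f) (p := U))).finrank_eq
  rw [hr, hk] at h
  exact h.symm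

theorem sup_span_eq_of_finrank [FiniteDimensional F V] {A W : Submodule F V} (hAW : A ≤ W)
    (hr : finrank F W ≤ finrank F A + 1) {v : V} (hv : v ∈ W) (hvA : v ∉ A) :
    A ⊔ Submodule.span F {v} = W := by
  refine Submodule.eq_of_le_of_finrank_le (sup_le hAW ?_) ?_
  · rwa [Submodule.span_singleton_le_iff_mem]
  · refine hr.trans (Submodule.finrank_lt_finrank_of_lt ?_)
    rw [lt_iff_le_and_ne]
    refine ⟨le_sup_left, fun h => hvA ?_⟩
    rw [h]
    exact Submodule.mem_sup_right (Submodule.mem_span_singleton_self v)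

theorem submodule_le_iff {P : Projectivization F V} {W : Submodule F V} : P.submodule ≤ W ↔ P.rep ∈ W := by
  rw [submodule_eq, Submodule.span_singleton_le_iff_mem]

theorem mk_submodule_le_iff {v : V} (hv : v ≠ 0) {W : Submodule F V} :
    (mk F v hv).submodule ≤ W ↔ v ∈ W := by
  rw [submodule_mk, Submodule.span_singleton_le_iff_mem]

theorem eq_of_submodule_le {P Q : Projectivization F V} (h : P.submodule ≤ Q.submodule) : P = Q := by
  apply submodule_injective
  exact Submodule.eq_of_le_of_finrank_eq h (by rw [finrank_submodule, finrank_submodule])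

theorem exists_point_of_ne_bot {W : Submodule F V} (h : W ≠ ⊥) : ∃ P : Projectivization F V, P.submodule ≤ W := by
  obtain ⟨v, hv, h0⟩ := Submodule.exists_mem_ne_zero_of_ne_bot h
  exact ⟨mk F v h0, (mk_submodule_le_iff h0).2 hv⟩

theorem finrank_sup_points [FiniteDimensional F V] {P Q : Projectivization F V} (h : P ≠ Q) :
    finrank F (P.submodule ⊔ Q.submodule : Submodule F V) = 2 := by
  have h1 := Submodule.finrank_sup_add_finrank_inf_eq P.submodule Q.submodule
  have h2 : P.submodule ⊓ Q.submodule = ⊥ := by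
    by_contra hne
    obtain ⟨R, hR⟩ := exists_point_of_ne_bot hne
    exact h ((eq_of_submodule_le (hR.trans inf_le_left)).symm.trans
      (eq_of_submodule_le (hR.trans inf_le_right)))
  rw [h2, finrank_bot, finrank_submodule, finrank_submodule] at h1
  omega

variable [Finite V]

instance : Fintype (Projectivization F V) := Fintype.ofFinite _

instance (l : Submodule F V) : Finite (V ⧸ l) := Finite.of_surjective _ l.mkQ_surjective

/-- The finite set of points of a projective subspace. -/
def projPts (W : Submodule F V) : Finset (Projectivization F V) := Finset.univ.filter fun P => P.submodule ≤ W

theorem mem_projPts {W : Submodule F V} {P : Projectivization F V} : P ∈ projPts W ↔ P.submodule ≤ W := by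
  simp [projPts]

theorem projPts_mono {U W : Submodule F V} (h : U ≤ W) : projPts U ⊆ projPts W := by
  intro P
  rw [mem_projPts, mem_projPts]
  exact fun hP => hP.trans h

theorem projPts_inter (U W : Submodule F V) : projPts U ∩ projPts W = projPts (U ⊓ W) := by
  ext P
  rw [Finset.mem_inter, mem_projPts, mem_projPts, mem_projPts, le_inf_iff]

theorem projPts_injective : Function.Injective (projPts : Submodule F V → Finset (Projectivization F V)) := by
  have : ∀ U W : Submodule F V, projPts U ⊆ projPts W → U ≤ W := by
    intro U W h v hv
    by_cases h0 : v = 0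
    · rw [h0]; exact W.zero_mem
    · have := @h (mk F v h0)
      rw [mem_projPts, mem_projPts, mk_submodule_le_iff, mk_submodule_le_iff] at this
      exact this hv
  intro U W h
  exact le_antisymm (this U W h.subset) (this W U h.symm.subset)

theorem card_projPts [Fintype F] {W : Submodule F V} {k : ℕ} (hW : finrank F W = k) :
    (projPts W).card = ∑ i ∈ Finset.range k, Fintype.card F ^ i := by
  have h1 : projPts W = Finset.univ.image
      (Projectivization.map W.subtype W.injective_subtype) := by
    ext P
    rw [mem_projPts, Finset.mem_image]
    constructor
    · intro h
      rw [submodule_le_iff] at h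
      refine ⟨mk F ⟨P.rep, h⟩ (fun e => P.rep_nonzero (congrArg Subtype.val e)), by simp, ?_⟩
      rw [map_mk]
      exact P.mk_rep
    · rintro ⟨Q, -, rfl⟩
      induction Q using Projectivization.ind with
      | h v hv =>
        rw [map_mk, mk_submodule_le_iff]
        exact v.2
  rw [h1, Finset.card_image_of_injective _ (map_injective _ _), Finset.card_univ,
    ← Nat.card_eq_fintype_card, card_of_finrank F W hW, Nat.card_eq_fintype_card]

theorem projPts_point (P : Projectivization F V) : projPts P.submodule = {P} := by
  ext Q
  rw [mem_projPts, Finset.mem_singleton]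
  exact ⟨eq_of_submodule_le, fun h => h ▸ le_rfl⟩

theorem projPts_eq_singleton {W : Submodule F V} (hW : finrank F W = 1) :
    ∃ P : Projectivization F V, projPts W = {P} :=
  ⟨mk'' W hW, by rw [← projPts_point, submodule_mk'' W hW]⟩

/-- Projecting from a subspace `l` partitions the points outside `l`. -/
theorem sum_card_comap_mkQ (l : Submodule F V) (S : Finset (Projectivization F V)) :
    ∑ x : Projectivization F (V ⧸ l), ((projPts (x.submodule.comap l.mkQ) ∩ S) \ projPts l).card =
      (S \ projPts l).card := by
  rw [← Finset.card_biUnion]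
  · congr 1
    ext P
    rw [Finset.mem_biUnion, Finset.mem_sdiff]
    constructor
    · rintro ⟨x, -, h⟩
      rw [Finset.mem_sdiff, Finset.mem_inter] at h
      exact ⟨h.1.2, h.2⟩
    · rintro ⟨h, h'⟩
      have h0 : l.mkQ P.rep ≠ 0 := by
        intro h0
        rw [mem_projPts, submodule_le_iff] at h'
        exact h' ((Submodule.Quotient.mk_eq_zero l).1 h0)
      refine ⟨mk F (l.mkQ P.rep) h0, Finset.mem_univ _, ?_⟩
      rw [Finset.mem_sdiff, Finset.mem_inter]
      refine ⟨⟨?_, h⟩, h'⟩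
      rw [mem_projPts, submodule_le_iff, Submodule.mem_comap, submodule_mk]
      exact Submodule.mem_span_singleton_self _
  · intro x _ y _ hxy
    rw [Function.onFun, Finset.disjoint_left]
    intro P hP hP'
    simp only [Finset.mem_sdiff, Finset.mem_inter, mem_projPts, submodule_le_iff,
      Submodule.mem_comap] at hP hP'
    have h0 : l.mkQ P.rep ≠ 0 := by
      intro h0
      exact hP.2 ((Submodule.Quotient.mk_eq_zero l).1 h0)
    exact hxy ((eq_of_submodule_le ((mk_submodule_le_iff h0).2 hP.1.1)).symm.trans
      (eq_of_submodule_le ((mk_submodule_le_iff h0).2 hP'.1.1)))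

end ProjPts

section Code

open Module

variable {p n : ℕ}

theorem exists_ker_eq {W : Submodule F (Fin (n + 1) → F)} (hW : finrank F W = n) :
    ∃ ψ : (Fin (n + 1) → F) →ₗ[F] F, LinearMap.ker ψ = W := by
  have h := W.finrank_quotient_add_finrank
  rw [hW, finrank_fin_fun] at h
  have e : ((Fin (n + 1) → F) ⧸ W) ≃ₗ[F] F :=
    LinearEquiv.ofFinrankEq _ _ (by rw [finrank_self]; omega)
  refine ⟨e.toLinearMap ∘ₗ W.mkQ, ?_⟩
  rw [LinearEquiv.ker_comp, Submodule.ker_mkQ]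

/-- The point sets of the lines contained in a subspace. -/
def linesIn {V : Type*} [AddCommGroup V] [Module F V] [Finite V] (U : Submodule F V) :
    Finset (Finset (Projectivization F V)) :=
  Finset.univ.filter fun s => ∃ l : Submodule F V, finrank F l = 2 ∧ l ≤ U ∧ s = projPts l

theorem mem_linesIn {V : Type*} [AddCommGroup V] [Module F V] [Finite V] {U : Submodule F V}
    {s : Finset (Projectivization F V)} :
    s ∈ linesIn U ↔ ∃ l : Submodule F V, finrank F l = 2 ∧ l ≤ U ∧ s = projPts l := by
  simp [linesIn]

theorem projPts_mem_linesIn {V : Type*} [AddCommGroup V] [Module F V] [Finite V]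
    {l U : Submodule F V} (hl : finrank F l = 2) (hlU : l ≤ U) : projPts l ∈ linesIn U :=
  mem_linesIn.2 ⟨l, hl, hlU, rfl⟩

variable [Fintype F]

/-- The support of a word, as a finite set. -/
def suppF (c : Pt F n → ZMod p) : Finset (Pt F n) := Finset.univ.filter fun P => c P ≠ 0

theorem mem_suppF {c : Pt F n → ZMod p} {P : Pt F n} : P ∈ suppF c ↔ c P ≠ 0 := by
  simp [suppF]

theorem wt_eq_card (c : Pt F n → ZMod p) : wt c = (suppF c).card := by
  rw [wt, ← Set.ncard_coe_finset]
  congr 1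
  ext P
  rw [Finset.mem_coe, mem_suppF]
  rfl

theorem hasMoments_code [Fact p.Prime] [CharP F p] {c : Pt F n → ZMod p} (hc : c ∈ code F p n)
    {r e f : Fin (n + 1) → F} (h0 : ∀ x y : F, f + x • r + y • e ≠ 0) :
    HasMoments fun x y => ZMod.castHom (dvd_refl p) F (c (mk F _ (h0 x y))) := by
  induction hc using Submodule.span_induction with
  | mem v hv =>
    obtain ⟨W, hW, rfl⟩ := hv
    obtain ⟨ψ, rfl⟩ := exists_ker_eq hW
    convert hasMoments_line (ψ r) (ψ e) (ψ f) using 3 with x y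
    rw [incVec, ptIn, mk_submodule_le_iff, LinearMap.mem_ker, map_add, map_add, map_smul, map_smul,
      smul_eq_mul, smul_eq_mul, apply_ite (ZMod.castHom (dvd_refl p) F), map_one, map_zero]
    refine if_congr ?_ rfl rfl
    rw [show ψ f + x * ψ r + y * ψ e = ψ r * x + ψ e * y + ψ f by ring]
  | zero => simpa using HasMoments.zero
  | add u v _ _ hu hv => simpa using hu.add hv
  | smul a v _ hv => simpa using hv.smul (ZMod.castHom (dvd_refl p) F a)

theorem hankel_bound [Fact p.Prime] [CharP F p] {c : Pt F n → ZMod p} (hc : c ∈ code F p n)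
    {U g m : Submodule F (Fin (n + 1) → F)} (hU : finrank F U = 3) (hg : finrank F g = 2)
    (hm : finrank F m = 2) (hgU : g ≤ U) (hmU : m ≤ U) (hne : g ≠ m) :
    ((projPts g ∩ suppF c) \ projPts m).card *
      (Fintype.card F + 1 - ((projPts g ∩ suppF c) \ projPts m).card) ≤
      ((projPts U ∩ suppF c) \ projPts m).card := by
  have hgm : finrank F (g ⊓ m : Submodule F _) ≠ 0 := by
    have h1 := Submodule.finrank_sup_add_finrank_inf_eq g m
    have h2 := Submodule.finrank_mono (sup_le hgU hmU)
    omega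
  have hgm' : ¬ g ≤ m := fun h => hne (Submodule.eq_of_le_of_finrank_eq h (by rw [hg, hm]))
  obtain ⟨f, hfg, hfm⟩ := Set.not_subset.1 hgm'
  obtain ⟨r, hr, hr0⟩ := Submodule.exists_mem_ne_zero_of_ne_bot (p := g ⊓ m) (by
    intro h; rw [h, finrank_bot] at hgm; exact hgm rfl)
  have hr1 : finrank F (Submodule.span F {r}) = 1 := finrank_span_singleton hr0
  have hrm : Submodule.span F {r} ≤ m := by
    rw [Submodule.span_singleton_le_iff_mem]; exact hr.2
  have hrg : Submodule.span F {r} ≤ g := by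
    rw [Submodule.span_singleton_le_iff_mem]; exact hr.1
  obtain ⟨e, hem, her⟩ : ∃ e ∈ m, e ∉ Submodule.span F {r} := by
    apply Set.not_subset.1
    intro h
    have := Submodule.finrank_mono (R := F) (s := m) (t := Submodule.span F {r}) h
    omega
  have hfm' : f ∉ m := hfm
  have hgeq := sup_span_eq_of_finrank hrg (by omega) hfg (fun h => hfm' (hrm h))
  have hxy : ∀ x y : F, x • r + y • e ∈ m := fun x y =>
    m.add_mem (m.smul_mem x hr.2) (m.smul_mem y hem)
  have h0 : ∀ x y : F, f + x • r + y • e ≠ 0 := by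
    intro x y h
    apply hfm'
    rw [add_assoc] at h
    rw [eq_neg_of_add_eq_zero_left h]
    exact m.neg_mem (hxy x y)
  have hindep : ∀ x y : F, x • r + y • e = 0 → x = 0 ∧ y = 0 := by
    intro x y h
    have hy : y = 0 := by
      by_contra hy
      apply her
      rw [Submodule.mem_span_singleton]
      refine ⟨-(y⁻¹ * x), ?_⟩
      have : e = y⁻¹ • (y • e) := by rw [smul_smul, inv_mul_cancel₀ hy, one_smul]
      rw [this, eq_neg_of_add_eq_zero_right h, smul_neg, smul_smul, neg_smul]
    subst hy
    rw [zero_smul, add_zero] at h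
    exact ⟨(smul_eq_zero.1 h).resolve_right hr0, rfl⟩
  have hinj : ∀ x y x' y', mk F _ (h0 x y) = mk F _ (h0 x' y') → x = x' ∧ y = y' := by
    intro x y x' y' h
    rw [mk_eq_mk_iff'] at h
    obtain ⟨a, ha⟩ := h
    have ha1 : a = 1 := by
      by_contra ha1
      apply hfm'
      have h1 : (a - 1) • f ∈ m := by
        have : (a - 1) • f = (x • r + y • e) - a • (x' • r + y' • e) := by
          rw [sub_smul, one_smul]
          have h2 : a • f + a • (x' • r + y' • e) = f + (x • r + y • e) := by
            rw [← smul_add, ← add_assoc, ← add_assoc]; exact ha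
          rw [sub_eq_sub_iff_add_eq_add, h2, add_comm f]
        rw [this]
        exact m.sub_mem (hxy x y) (m.smul_mem a (hxy x' y'))
      exact (m.smul_mem_iff (sub_ne_zero.2 ha1)).1 h1
    subst ha1
    rw [one_smul, add_assoc, add_assoc, add_right_inj] at ha
    have h3 := hindep (x - x') (y - y') (by
      rw [sub_smul, sub_smul, sub_add_sub_comm, ha, sub_self])
    exact ⟨sub_eq_zero.1 h3.1, sub_eq_zero.1 h3.2⟩
  have hU' : ∀ x y, mk F _ (h0 x y) ∈ projPts U ∧ mk F _ (h0 x y) ∉ projPts m := by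
    intro x y
    rw [mem_projPts, mem_projPts, mk_submodule_le_iff, mk_submodule_le_iff, add_assoc]
    exact ⟨U.add_mem (hgU hfg) (hmU (hxy x y)),
      fun h => hfm' ((m.add_mem_iff_left (hxy x y)).1 h)⟩
  have hg' : ∀ P, P ∈ projPts g → P ∉ projPts m → ∃ x, P = mk F _ (h0 x 0) := by
    intro P hP hPm
    rw [mem_projPts, submodule_le_iff] at hP hPm
    rw [← hgeq, Submodule.mem_sup] at hP
    obtain ⟨u, hu, v, hv, huv⟩ := hP
    rw [Submodule.mem_span_singleton] at hu hv
    obtain ⟨a, rfl⟩ := hu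
    obtain ⟨b, rfl⟩ := hv
    have hb : b ≠ 0 := by
      rintro rfl
      apply hPm
      rw [← huv, zero_smul, add_zero]
      exact m.smul_mem a hr.2
    refine ⟨b⁻¹ * a, ?_⟩
    rw [← P.mk_rep, mk_eq_mk_iff']
    refine ⟨b, ?_⟩
    rw [zero_smul, add_zero, smul_add, smul_smul, mul_inv_cancel_left₀ hb, ← huv, add_comm (b • f)]
  have hG := hasMoments_code hc h0
  have hiff : ∀ x y, ZMod.castHom (dvd_refl p) F (c (mk F _ (h0 x y))) ≠ 0 ↔
      mk F _ (h0 x y) ∈ suppF c := by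
    intro x y
    rw [mem_suppF, map_ne_zero]
  have hgy : ∀ x, mk F _ (h0 x 0) ∈ projPts g := by
    intro x
    rw [mem_projPts, mk_submodule_le_iff, zero_smul, add_zero]
    exact g.add_mem hfg (g.smul_mem x hr.1)
  have hcard0 : (Finset.univ.filter fun x : F =>
      ZMod.castHom (dvd_refl p) F (c (mk F _ (h0 x 0))) ≠ 0).card =
      ((projPts g ∩ suppF c) \ projPts m).card := by
    rw [← Finset.card_image_of_injective (f := fun x => mk F _ (h0 x 0))
      (Finset.univ.filter fun x : F => ZMod.castHom (dvd_refl p) F (c (mk F _ (h0 x 0))) ≠ 0)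
      (fun x x' h => (hinj _ _ _ _ h).1)]
    congr 1
    ext P
    rw [Finset.mem_image, Finset.mem_sdiff, Finset.mem_inter]
    constructor
    · rintro ⟨x, hx, rfl⟩
      rw [Finset.mem_filter, hiff] at hx
      exact ⟨⟨hgy x, hx.2⟩, (hU' x 0).2⟩
    · rintro ⟨⟨h1, h2⟩, h3⟩
      obtain ⟨x, rfl⟩ := hg' P h1 h3
      exact ⟨x, Finset.mem_filter.2 ⟨Finset.mem_univ _, (hiff x 0).2 h2⟩, rfl⟩
  refine (hG.card_le 0 hcard0).trans ?_
  rw [← Finset.card_sigma]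
  refine Finset.card_le_card_of_injOn (fun s => mk F _ (h0 s.2 s.1)) ?_ ?_
  · rintro ⟨y, x⟩ hs
    simp only [Finset.coe_sigma, Set.mem_sigma_iff, Finset.mem_coe, Finset.mem_filter] at hs
    rw [Finset.mem_coe, Finset.mem_sdiff, Finset.mem_inter]
    exact ⟨⟨(hU' x y).1, (hiff x y).1 hs.2.2⟩, (hU' x y).2⟩
  · rintro ⟨y, x⟩ - ⟨y', x'⟩ - h
    obtain ⟨rfl, rfl⟩ := hinj _ _ _ _ h
    rfl

theorem hankelPlane_code [Fact p.Prime] [CharP F p] {c : Pt F n → ZMod p} (hc : c ∈ code F p n)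
    {U : Submodule F (Fin (n + 1) → F)} (hU : finrank F U = 3) :
    HankelPlane (Fintype.card F) (projPts U) (projPts U ∩ suppF c) (linesIn U) where
  sub := by
    intro l hl
    obtain ⟨l, -, h, rfl⟩ := mem_linesIn.1 hl
    exact projPts_mono h
  card_line := by
    intro l hl
    obtain ⟨l, h, -, rfl⟩ := mem_linesIn.1 hl
    rw [card_projPts h, Finset.sum_range_succ, Finset.sum_range_one, pow_zero, pow_one, add_comm]
  join := by
    intro P hP Q hQ hPQ
    rw [mem_projPts] at hP hQ
    refine ⟨_, projPts_mem_linesIn (finrank_sup_points hPQ) (sup_le hP hQ), ?_, ?_⟩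
    · rw [mem_projPts]; exact le_sup_left
    · rw [mem_projPts]; exact le_sup_right
  meet := by
    intro l hl m hm hlm
    obtain ⟨l, h, hlU, rfl⟩ := mem_linesIn.1 hl
    obtain ⟨m, h', hmU, rfl⟩ := mem_linesIn.1 hm
    rw [projPts_inter]
    apply projPts_eq_singleton
    have h1 := Submodule.finrank_sup_add_finrank_inf_eq l m
    have h2 := Submodule.finrank_mono (sup_le hlU hmU)
    have h3 : finrank F (l ⊓ m : Submodule F _) ≠ 2 := by
      intro h3
      have e1 := Submodule.eq_of_le_of_finrank_eq (inf_le_left : l ⊓ m ≤ l) (by rw [h3, h])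
      have e2 := Submodule.eq_of_le_of_finrank_eq (inf_le_right : l ⊓ m ≤ m) (by rw [h3, h'])
      exact hlm (by rw [← e1, e2])
    have h4 := Submodule.finrank_mono (inf_le_left : l ⊓ m ≤ l)
    omega
  card_plane := by
    rw [card_projPts hU]
    simp only [Finset.sum_range_succ, Finset.sum_range_zero]
    ring
  S_sub := Finset.inter_subset_left
  hankel := by
    intro g hg m hm hgm
    obtain ⟨g, h, hgU, rfl⟩ := mem_linesIn.1 hg
    obtain ⟨m, h', hmU, rfl⟩ := mem_linesIn.1 hm
    have := hankel_bound hc hU h h' hgU hmU (fun e => hgm (by rw [e]))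
    have e : projPts g ∩ (projPts U ∩ suppF c) = projPts g ∩ suppF c := by
      rw [← Finset.inter_assoc, Finset.inter_eq_left.2 (projPts_mono hgU)]
    rw [e]
    exact this

theorem exists_line_sum [Fact p.Prime] [CharP F p] {c : Pt F n → ZMod p} (hc : c ∈ code F p n) :
    ∃ κ : ZMod p, ∀ l : Submodule F (Fin (n + 1) → F), finrank F l = 2 →
      ∑ P ∈ projPts l, c P = κ := by
  have hq0 : (Fintype.card F : ZMod p) = 0 := by
    rw [CharP.cast_eq_zero_iff (ZMod p) p]
    rw [← CharP.cast_eq_zero_iff F p]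
    exact FiniteField.cast_card_eq_zero F
  induction hc using Submodule.span_induction with
  | mem v hv =>
    obtain ⟨W, hW, rfl⟩ := hv
    refine ⟨1, fun l hl => ?_⟩
    have h1 : ∑ P ∈ projPts l, incVec p W P = ((projPts (l ⊓ W)).card : ZMod p) := by
      simp only [incVec]
      rw [Finset.sum_boole, ← projPts_inter]
      congr 2
      ext P
      rw [Finset.mem_filter, Finset.mem_inter, mem_projPts (W := W)]
      rfl
    rw [h1, card_projPts rfl]
    have h2 := Submodule.finrank_sup_add_finrank_inf_eq l W
    have h3 := Submodule.finrank_le (l ⊔ W)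
    rw [finrank_fin_fun] at h3
    obtain ⟨k, hk⟩ : ∃ k, finrank F (l ⊓ W : Submodule F _) = k + 1 :=
      Nat.exists_eq_succ_of_ne_zero (by omega)
    rw [hk, Finset.sum_range_succ', pow_zero]
    push_cast
    rw [hq0]
    simp
  | zero => exact ⟨0, fun l _ => by simp⟩
  | add u v _ _ hu hv =>
    obtain ⟨a, ha⟩ := hu
    obtain ⟨b, hb⟩ := hv
    exact ⟨a + b, fun l hl => by simp [Finset.sum_add_distrib, ha l hl, hb l hl]⟩
  | smul t v _ hv =>
    obtain ⟨a, ha⟩ := hv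
    exact ⟨t * a, fun l hl => by simp [← Finset.mul_sum, ha l hl]⟩

end Code

section Global

open Module

variable {p n : ℕ}

theorem finrank_comap_mkQ (l : Submodule F (Fin (n + 1) → F))
    (x : Projectivization F ((Fin (n + 1) → F) ⧸ l)) :
    finrank F (x.submodule.comap l.mkQ) = finrank F l + 1 := by
  rw [finrank_comap_of_surjective _ l.mkQ_surjective, Submodule.ker_mkQ, finrank_submodule,
    add_comm]

variable [Fintype F]

theorem card_projectivization_quotient (l : Submodule F (Fin (n + 1) → F)) {k : ℕ}
    (h : finrank F l + k = n + 1) :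
    Fintype.card (Projectivization F ((Fin (n + 1) → F) ⧸ l)) =
      ∑ i ∈ Finset.range k, Fintype.card F ^ i := by
  have h1 := l.finrank_quotient_add_finrank
  rw [finrank_fin_fun] at h1
  rw [← Nat.card_eq_fintype_card, card_of_finrank F _ (show _ = k by omega),
    Nat.card_eq_fintype_card]

/-- Summing a lower bound over all planes through a line. -/
theorem mul_le_card_sdiff_line (S : Finset (Pt F n)) {l : Submodule F (Fin (n + 1) → F)}
    (hn : 2 ≤ n) (hl : finrank F l = 2) {k : ℕ}
    (h : ∀ U : Submodule F (Fin (n + 1) → F), finrank F U = 3 → l ≤ U →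
      k ≤ ((projPts U ∩ S) \ projPts l).card) :
    k * ∑ i ∈ Finset.range (n - 1), Fintype.card F ^ i ≤ (S \ projPts l).card := by
  rw [← card_projectivization_quotient l (k := n - 1) (by omega), ← sum_card_comap_mkQ l S,
    mul_comm, ← smul_eq_mul, ← Finset.card_univ]
  refine Finset.card_nsmul_le_sum _ _ _ fun x _ => h _ ?_ ?_
  · rw [finrank_comap_mkQ, hl]
  · exact (Submodule.ker_mkQ l).symm.le.trans (LinearMap.ker_le_comap _)

theorem mul_lt_card_sdiff_line (S : Finset (Pt F n)) {l : Submodule F (Fin (n + 1) → F)}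
    (hn : 2 ≤ n) (hl : finrank F l = 2) {k : ℕ}
    (h : ∀ U : Submodule F (Fin (n + 1) → F), finrank F U = 3 → l ≤ U →
      k ≤ ((projPts U ∩ S) \ projPts l).card)
    (h' : ∃ U : Submodule F (Fin (n + 1) → F), finrank F U = 3 ∧ l ≤ U ∧
      k < ((projPts U ∩ S) \ projPts l).card) :
    k * ∑ i ∈ Finset.range (n - 1), Fintype.card F ^ i < (S \ projPts l).card := by
  obtain ⟨U, hU, hlU, hk⟩ := h'
  have hlt : l ≠ U := by rintro rfl; omega
  obtain ⟨v, hvU, hvl⟩ := Set.not_subset.1 (fun h => hlt (le_antisymm hlU h))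
  have hv0 : l.mkQ v ≠ 0 := fun h0 => hvl ((Submodule.Quotient.mk_eq_zero l).1 h0)
  have hle : ∀ x : Projectivization F ((Fin (n + 1) → F) ⧸ l), l ≤ x.submodule.comap l.mkQ :=
    fun x => (Submodule.ker_mkQ l).symm.le.trans (LinearMap.ker_le_comap _)
  have hx : (mk F _ hv0).submodule.comap l.mkQ = U := by
    have hv : v ∈ (mk F _ hv0).submodule.comap l.mkQ := by
      rw [Submodule.mem_comap, submodule_mk]
      exact Submodule.mem_span_singleton_self _
    rw [← sup_span_eq_of_finrank (hle _) (by rw [finrank_comap_mkQ]) hv hvl,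
      sup_span_eq_of_finrank hlU (by omega) hvU hvl]
  rw [← card_projectivization_quotient l (k := n - 1) (by omega), ← sum_card_comap_mkQ l S,
    mul_comm, ← smul_eq_mul, ← Finset.card_univ, ← Finset.sum_const]
  refine Finset.sum_lt_sum (fun x _ => h _ ?_ (hle x)) ⟨mk F _ hv0, Finset.mem_univ _, ?_⟩
  · rw [finrank_comap_mkQ, hl]
  · rw [hx]; exact hk

theorem one_le_sum_pow {q m : ℕ} (hm : 1 ≤ m) : 1 ≤ ∑ i ∈ Finset.range m, q ^ i := by
  obtain ⟨m, rfl⟩ := Nat.exists_eq_add_of_le' hm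
  rw [Finset.sum_range_succ', pow_zero]
  omega

theorem projPts_inter_inter {U l : Submodule F (Fin (n + 1) → F)} (h : l ≤ U)
    (S : Finset (Pt F n)) : projPts l ∩ (projPts U ∩ S) = projPts l ∩ S := by
  rw [← Finset.inter_assoc, Finset.inter_eq_left.2 (projPts_mono h)]

variable [Fact p.Prime] [CharP F p] {c : Pt F n → ZMod p}

theorem secant_spec (hc : c ∈ code F p n) (hn : 2 ≤ n) (hq : 3 ≤ Fintype.card F)
    (hw : (suppF c).card ≤
      (3 * Fintype.card F - 6) * ∑ i ∈ Finset.range (n - 1), Fintype.card F ^ i + 2)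
    {l : Submodule F (Fin (n + 1) → F)} (hl : finrank F l = 2) :
    ((projPts l ∩ suppF c).card ≤ 2 ∨ Fintype.card F ≤ (projPts l ∩ suppF c).card) ∧
      (Fintype.card F = 3 → (projPts l ∩ suppF c).card ≠ 2) := by
  have hθ := one_le_sum_pow (q := Fintype.card F) (show 1 ≤ n - 1 by omega)
  have hadd : ∀ l : Submodule F (Fin (n + 1) → F),
      (projPts l ∩ suppF c).card + (suppF c \ projPts l).card = (suppF c).card := by
    intro l
    rw [Finset.inter_comm, Finset.card_inter_add_card_sdiff]
  have htwo : ∀ l : Submodule F (Fin (n + 1) → F), finrank F l = 2 →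
      2 ≤ (projPts l ∩ suppF c).card → (projPts l ∩ suppF c).card ≤ Fintype.card F - 1 →
      2 * (Fintype.card F - 1) * ∑ i ∈ Finset.range (n - 1), Fintype.card F ^ i ≤
        (suppF c \ projPts l).card := by
    intro l hl h2 h3
    refine mul_le_card_sdiff_line _ hn hl fun U hU hlU => ?_
    refine (hankelPlane_code hc hU).off_ge_of_two_le hq (projPts_mem_linesIn hl hlU) ?_ ?_
    · rwa [projPts_inter_inter hlU]
    · rwa [projPts_inter_inter hlU]
  have hthree : 5 ≤ Fintype.card F → ∀ l : Submodule F (Fin (n + 1) → F), finrank F l = 2 →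
      (projPts l ∩ suppF c).card ≤ 2 ∨ Fintype.card F - 1 ≤ (projPts l ∩ suppF c).card := by
    intro h5 l hl
    by_contra! hcon
    have h1 := mul_le_card_sdiff_line (suppF c) hn hl (k := 3 * Fintype.card F - 6)
      fun U hU hlU => by
        refine (hankelPlane_code hc hU).off_ge_of_three_le h5 (projPts_mem_linesIn hl hlU) ?_ ?_
        · rw [projPts_inter_inter hlU]; omega
        · rw [projPts_inter_inter hlU]; omega
    have h2 := hadd l
    omega
  have h4 := hadd l
  constructor
  · by_contra! hcon
    rcases lt_or_ge (Fintype.card F) 5 with h5 | h5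
    · have h6 : Fintype.card F = 4 := by omega
      have h7 := htwo l hl (by omega) (by omega)
      rw [h6] at h7 hw
      omega
    · have h6 := hthree h5 l hl
      have h1 := mul_le_card_sdiff_line (suppF c) hn hl (k := 3 * Fintype.card F - 6)
        fun U hU hlU => by
          refine (hankelPlane_code hc hU).off_ge_of_eq_sub_one h5 (projPts_mem_linesIn hl hlU) ?_ ?_
          · intro g hg
            obtain ⟨g, hg₂, hgU, rfl⟩ := mem_linesIn.1 hg
            rw [projPts_inter_inter hgU]
            exact hthree h5 g hg₂
          · rw [projPts_inter_inter hlU]; omega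
      omega
  · intro h3 h2
    have h7 := htwo l hl (by omega) (by omega)
    rw [h3] at h7 hw hθ
    omega

/-- The values of `c` on a line meeting its support in at least `q` points. -/
theorem long_line_spec (hc : c ∈ code F p n) (hn : 2 ≤ n) (hq : 3 ≤ Fintype.card F)
    (hw : (suppF c).card ≤
      (3 * Fintype.card F - 6) * ∑ i ∈ Finset.range (n - 1), Fintype.card F ^ i + 2)
    {κ : ZMod p} (hκ : ∀ l : Submodule F (Fin (n + 1) → F), finrank F l = 2 →
      ∑ P ∈ projPts l, c P = κ)
    {l : Submodule F (Fin (n + 1) → F)} (hl : finrank F l = 2)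
    (hls : Fintype.card F ≤ (projPts l ∩ suppF c).card) :
    ∃ z ∈ projPts l, c z = κ ∧ ∃ a, a ≠ 0 ∧ ∀ Q ∈ projPts l, Q ≠ z → c Q = a := by
  obtain ⟨U, hU, hlU, P, hPl, hP, hun⟩ : ∃ U : Submodule F (Fin (n + 1) → F), finrank F U = 3 ∧
      l ≤ U ∧ ∃ P ∈ projPts l, P ∈ suppF c ∧ ∀ g : Submodule F (Fin (n + 1) → F),
        finrank F g = 2 → g ≤ U → g ≠ l → P ∈ projPts g →
        (projPts g ∩ suppF c).card < Fintype.card F := by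
    by_contra! hcon
    have h1 := mul_le_card_sdiff_line (suppF c) hn hl (k := 3 * Fintype.card F - 6)
      fun U hU hlU => by
        refine (hankelPlane_code hc hU).off_ge_of_forall_long hq (projPts_mem_linesIn hl hlU) ?_ ?_
        · rwa [projPts_inter_inter hlU]
        · intro P hPl hP
          obtain ⟨g, hg, hgU, hgl, hPg, hgs⟩ := hcon U hU hlU P hPl (Finset.mem_inter.1 hP).2
          refine ⟨_, projPts_mem_linesIn hg hgU, fun h => hgl (projPts_injective h), hPg, ?_⟩
          rwa [projPts_inter_inter hgU]
    have h2 := Finset.card_inter_add_card_sdiff (suppF c) (projPts l)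
    rw [Finset.inter_comm] at h2
    omega
  have H := hankelPlane_code hc hU
  have hlΛ := projPts_mem_linesIn hl hlU
  have hcU : ∀ P ∈ projPts U, P ∈ projPts U ∩ suppF c ↔ c P ≠ 0 := by
    intro P hP
    rw [Finset.mem_inter, mem_suppF]
    exact ⟨fun h => h.2, fun h => ⟨hP, h⟩⟩
  obtain ⟨z, hz, a, ha⟩ := H.exists_const_of_unique_long (κ := κ) (c := c) hq
    (fun g hg => by
      obtain ⟨g, hg₂, hgU, rfl⟩ := mem_linesIn.1 hg
      rw [projPts_inter_inter hgU]
      exact (secant_spec hc hn hq hw hg₂).1)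
    (fun h3 g hg => by
      obtain ⟨g, hg₂, hgU, rfl⟩ := mem_linesIn.1 hg
      rw [projPts_inter_inter hgU]
      exact (secant_spec hc hn hq hw hg₂).2 h3)
    hcU
    (fun g hg => by
      obtain ⟨g, hg₂, hgU, rfl⟩ := mem_linesIn.1 hg
      exact hκ g hg₂)
    hlΛ hPl (Finset.mem_inter.2 ⟨projPts_mono hlU hPl, hP⟩)
    (fun g hg hgl hPg => by
      obtain ⟨g, hg₂, hgU, rfl⟩ := mem_linesIn.1 hg
      rw [projPts_inter_inter hgU]
      exact hun g hg₂ hgU (fun h => hgl (by rw [h])) hPg)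
  have hq0 : (Fintype.card F : ZMod p) = 0 := by
    rw [CharP.cast_eq_zero_iff (ZMod p) p, ← CharP.cast_eq_zero_iff F p]
    exact FiniteField.cast_card_eq_zero F
  have hspec := HankelPlane.const_spec (S := suppF c) (κ := κ) hq hq0 (H.card_line _ hlΛ) (hκ l hl)
    (fun P _ => mem_suppF) hls hz ha
  exact ⟨z, hz, hspec.1, a, hspec.2, ha⟩

/-- Two lines through `P` that meet the support in at least `q` points force the same for all lines
through `P` in the plane they span. -/
theorem long_of_two_long (hc : c ∈ code F p n) (hn : 2 ≤ n) (hq : 3 ≤ Fintype.card F)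
    (hw : (suppF c).card ≤
      (3 * Fintype.card F - 6) * ∑ i ∈ Finset.range (n - 1), Fintype.card F ^ i + 2)
    {κ : ZMod p} (hκ : ∀ l : Submodule F (Fin (n + 1) → F), finrank F l = 2 →
      ∑ P ∈ projPts l, c P = κ)
    {P : Pt F n} (hP : c P ≠ 0) (hPall : c P ≠ κ ∨ ∀ Q, c Q ≠ 0 → c Q = κ)
    {U l₁ l₂ f : Submodule F (Fin (n + 1) → F)} (hU : finrank F U = 3)
    (h₁ : finrank F l₁ = 2) (h₂ : finrank F l₂ = 2) (hf : finrank F f = 2) (h₁₂ : l₁ ≠ l₂)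
    (h₁U : l₁ ≤ U) (h₂U : l₂ ≤ U) (hfU : f ≤ U)
    (hP₁ : P.submodule ≤ l₁) (hP₂ : P.submodule ≤ l₂) (hPf : P.submodule ≤ f)
    (hs₁ : Fintype.card F ≤ (projPts l₁ ∩ suppF c).card)
    (hs₂ : Fintype.card F ≤ (projPts l₂ ∩ suppF c).card) :
    Fintype.card F ≤ (projPts f ∩ suppF c).card := by
  have H := hankelPlane_code hc hU
  have hcU : ∀ P ∈ projPts U, P ∈ projPts U ∩ suppF c ↔ c P ≠ 0 := by
    intro P hP
    rw [Finset.mem_inter, mem_suppF]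
    exact ⟨fun h => h.2, fun h => ⟨hP, h⟩⟩
  have hs : ∀ g ∈ linesIn U, (g ∩ (projPts U ∩ suppF c)).card ≤ 2 ∨
      Fintype.card F ≤ (g ∩ (projPts U ∩ suppF c)).card := by
    intro g hg
    obtain ⟨g, hg₂, hgU, rfl⟩ := mem_linesIn.1 hg
    rw [projPts_inter_inter hgU]
    exact (secant_spec hc hn hq hw hg₂).1
  have hs3 : Fintype.card F = 3 → ∀ g ∈ linesIn U, (g ∩ (projPts U ∩ suppF c)).card ≠ 2 := by
    intro h3 g hg
    obtain ⟨g, hg₂, hgU, rfl⟩ := mem_linesIn.1 hg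
    rw [projPts_inter_inter hgU]
    exact (secant_spec hc hn hq hw hg₂).2 h3
  have hκU : ∀ g ∈ linesIn U, ∑ P ∈ g, c P = κ := by
    intro g hg
    obtain ⟨g, hg₂, hgU, rfl⟩ := mem_linesIn.1 hg
    exact hκ g hg₂
  have hsp : ∀ l ∈ linesIn U, Fintype.card F ≤ (l ∩ (projPts U ∩ suppF c)).card →
      ∃ z ∈ l, c z = κ ∧ ∃ a, a ≠ 0 ∧ ∀ Q ∈ l, Q ≠ z → c Q = a := by
    intro l hl hls
    obtain ⟨l, hl₂, hlU, rfl⟩ := mem_linesIn.1 hl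
    rw [projPts_inter_inter hlU] at hls
    exact long_line_spec hc hn hq hw hκ hl₂ hls
  have h₁' := projPts_mem_linesIn h₁ h₁U
  have h₂' := projPts_mem_linesIn h₂ h₂U
  have hf' := projPts_mem_linesIn hf hfU
  have h₁₂' : projPts l₁ ≠ projPts l₂ := fun h => h₁₂ (projPts_injective h)
  rw [← projPts_inter_inter h₁U] at hs₁
  rw [← projPts_inter_inter h₂U] at hs₂
  rw [← mem_projPts] at hP₁ hP₂ hPf
  by_cases hκ0 : κ = 0
  · subst hκ0
    have hPS : P ∈ projPts U ∩ suppF c := (hcU P (projPts_mono h₁U hP₁)).2 hP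
    have hq2 : (2 : ZMod p) = 0 → Fintype.card F = 4 ∨ 8 ≤ Fintype.card F := by
      intro h2
      have hp2 : p = 2 := by
        have h3 : ((2 : ℕ) : ZMod p) = 0 := by exact_mod_cast h2
        rw [CharP.cast_eq_zero_iff (ZMod p) p] at h3
        exact (Nat.prime_dvd_prime_iff_eq Fact.out Nat.prime_two).1 h3
      obtain ⟨k, -, hk⟩ := FiniteField.card F p
      rw [hp2] at hk
      have hk1 : 1 < (k : ℕ) := by
        by_contra hk1
        have : (k : ℕ) ≤ 1 := by omega
        have := Nat.pow_le_pow_right (n := 2) (by norm_num) this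
        omega
      rcases Nat.lt_or_ge 2 (k : ℕ) with h | h
      · right
        rw [hk]
        exact Nat.pow_le_pow_right (n := 2) (by norm_num) (show 3 ≤ (k : ℕ) from h)
      · left
        rw [hk, show (k : ℕ) = 2 by omega]
        norm_num
    rcases H.long_of_two_long_of_zero hq hq2 hs hs3 hcU hκU hsp hPS h₁' h₂' hf' h₁₂' hP₁ hP₂ hPf
      hs₁ hs₂ with h | ⟨h4, hf2, h7⟩
    · rwa [projPts_inter_inter hfU] at h
    · exfalso
      rw [projPts_inter_inter hfU] at hf2
      have h8 := mul_lt_card_sdiff_line (suppF c) hn hf (k := 6)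
        (fun W hW hfW => by
          have := (hankelPlane_code hc hW).off_ge_of_two_le hq (projPts_mem_linesIn hf hfW)
            (by rw [projPts_inter_inter hfW]; omega) (by rw [projPts_inter_inter hfW]; omega)
          omega)
        ⟨U, hU, hfU, h7⟩
      have h9 := Finset.card_inter_add_card_sdiff (suppF c) (projPts f)
      rw [Finset.inter_comm] at h9
      rw [h4] at h8 hw
      omega
  · have h := H.long_of_two_long_of_ne_zero hq hs hcU hκU hsp hκ0 hPall h₁' h₂' hf' h₁₂' hP₁ hP₂
      hs₁ hs₂
    rwa [projPts_inter_inter hfU] at h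

end Global

section Final

open Module

variable {p n : ℕ}

theorem incVec_mem_code {K : Submodule F (Fin (n + 1) → F)} (hK : finrank F K = n) :
    incVec p K ∈ code F p n :=
  Submodule.subset_span ⟨K, hK, rfl⟩

theorem exists_le_finrank_eq {A B : Submodule F (Fin (n + 1) → F)} (hAB : A ≤ B) {k : ℕ}
    (h1 : finrank F A ≤ k) (h2 : k ≤ finrank F B) :
    ∃ K : Submodule F (Fin (n + 1) → F), A ≤ K ∧ K ≤ B ∧ finrank F K = k := by
  induction k, h1 using Nat.le_induction with
  | base => exact ⟨A, le_rfl, hAB, rfl⟩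
  | succ k _ ih =>
    obtain ⟨K, hAK, hKB, hK⟩ := ih (by omega)
    obtain ⟨v, hvB, hvK⟩ := SetLike.not_le_iff_exists.1 (fun h : B ≤ K => by
      have := Submodule.finrank_mono h
      omega)
    refine ⟨K ⊔ Submodule.span F {v}, hAK.trans le_sup_left, sup_le hKB ?_, ?_⟩
    · rwa [Submodule.span_singleton_le_iff_mem]
    · rw [Submodule.finrank_sup_span_singleton hvK, hK]

theorem exists_hyperplane_ne (hn : 1 ≤ n) (K : Submodule F (Fin (n + 1) → F)) :
    ∃ H : Submodule F (Fin (n + 1) → F), finrank F H = n ∧ H ≠ K := by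
  have htop : finrank F (⊤ : Submodule F (Fin (n + 1) → F)) = n + 1 := by
    rw [finrank_top, finrank_fin_fun]
  by_cases hK : K = ⊤
  · obtain ⟨H, -, -, hH⟩ := exists_le_finrank_eq (bot_le (a := (⊤ : Submodule F (Fin (n + 1) → F))))
      (k := n) (by simp) (by omega)
    exact ⟨H, hH, by rintro rfl; rw [hK] at hH; omega⟩
  · obtain ⟨v, -, hv⟩ := SetLike.exists_of_lt (lt_top_iff_ne_top.2 hK)
    have hv1 : finrank F (Submodule.span F {v}) ≤ 1 := finrank_span_le_card ({v} : Set _) |>.trans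
      (by simp)
    obtain ⟨H, hvH, -, hH⟩ := exists_le_finrank_eq (le_top (a := Submodule.span F {v}))
      (k := n) (by omega) (by omega)
    refine ⟨H, hH, ?_⟩
    rintro rfl
    exact hv (hvH (Submodule.mem_span_singleton_self v))

/-- A subspace through `P` meeting every plane through `P` in at least a line contains a
hyperplane. -/
theorem le_finrank_of_meets_planes {P : Pt F n} {W : Submodule F (Fin (n + 1) → F)}
    (hPW : P.submodule ≤ W)
    (h : ∀ U : Submodule F (Fin (n + 1) → F), finrank F U = 3 → P.submodule ≤ U →
      ∃ A : Submodule F (Fin (n + 1) → F), finrank F A = 2 ∧ A ≤ U ∧ A ≤ W) :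
    n ≤ finrank F W := by
  by_contra! hlt
  have hex : ∀ W : Submodule F (Fin (n + 1) → F), finrank F W ≤ n → ∃ v, v ∉ W := by
    intro W hW
    by_contra! hall
    have : W = ⊤ := (Submodule.eq_top_iff').2 hall
    rw [this, finrank_top, finrank_fin_fun] at hW
    omega
  obtain ⟨u, hu⟩ := hex W hlt.le
  have h1 := Submodule.finrank_sup_span_singleton (K := F) hu
  obtain ⟨v, hv⟩ := hex (W ⊔ Submodule.span F {u}) (by omega)
  have h2 := Submodule.finrank_sup_span_singleton (K := F) hv
  have hu' : u ∉ P.submodule := fun h => hu (hPW h)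
  have hv' : v ∉ P.submodule ⊔ Submodule.span F {u} := fun h => hv (sup_le_sup_right hPW _ h)
  have h3 := Submodule.finrank_sup_span_singleton (K := F) hu'
  have h4 := Submodule.finrank_sup_span_singleton (K := F) hv'
  rw [finrank_submodule] at h3
  obtain ⟨A, hA, hAU, hAW⟩ := h (P.submodule ⊔ Submodule.span F {u} ⊔ Submodule.span F {v})
    (by omega) (le_sup_left.trans le_sup_left)
  have h5 := Submodule.finrank_sup_add_finrank_inf_eq W
    (P.submodule ⊔ Submodule.span F {u} ⊔ Submodule.span F {v})
  have h6 : W ⊔ (P.submodule ⊔ Submodule.span F {u} ⊔ Submodule.span F {v}) =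
      W ⊔ Submodule.span F {u} ⊔ Submodule.span F {v} := by
    rw [← sup_assoc, ← sup_assoc, sup_eq_left.2 hPW]
  have h7 := Submodule.finrank_mono (le_inf hAW hAU)
  rw [h6] at h5
  omega

/-- The union of a family of lines through `P` that is closed under taking lines through `P` in the
plane of two of its members. -/
def coneSubmodule (P : Pt F n) (L : Set (Submodule F (Fin (n + 1) → F))) (hne : L.Nonempty)
    (hP : ∀ A ∈ L, P.submodule ≤ A)
    (hL : ∀ A ∈ L, ∀ B ∈ L, A ≠ B → ∀ f : Submodule F (Fin (n + 1) → F), finrank F f = 2 →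
      P.submodule ≤ f → f ≤ A ⊔ B → f ∈ L) : Submodule F (Fin (n + 1) → F) where
  carrier := {v | ∃ A ∈ L, v ∈ A}
  zero_mem' := by
    obtain ⟨A, hA⟩ := hne
    exact ⟨A, hA, A.zero_mem⟩
  smul_mem' := by
    rintro a v ⟨A, hA, hv⟩
    exact ⟨A, hA, A.smul_mem a hv⟩
  add_mem' := by
    rintro u v ⟨A, hA, hu⟩ ⟨B, hB, hv⟩
    by_cases hAB : A = B
    · subst hAB
      exact ⟨A, hA, A.add_mem hu hv⟩
    by_cases huv : u + v ∈ P.submodule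
    · exact ⟨A, hA, hP A hA huv⟩
    refine ⟨P.submodule ⊔ Submodule.span F {u + v}, hL A hA B hB hAB _ ?_ le_sup_left ?_,
      Submodule.mem_sup_right (Submodule.mem_span_singleton_self _)⟩
    · rw [Submodule.finrank_sup_span_singleton huv, finrank_submodule]
    · refine sup_le ((hP A hA).trans le_sup_left) ?_
      rw [Submodule.span_singleton_le_iff_mem]
      exact Submodule.add_mem_sup hu hv

variable [Fintype F]

/-- A set of points of a hyperplane `K` meeting every line of `K` through `P` in at most one point
has at most as many points as there are such lines. -/
theorem card_le_of_lines_le_one {P : Pt F n} {K : Submodule F (Fin (n + 1) → F)}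
    (hK : finrank F K = n) (hPK : P.submodule ≤ K) {E : Finset (Pt F n)} (hEK : E ⊆ projPts K)
    (hPE : P ∉ E)
    (h : ∀ A : Submodule F (Fin (n + 1) → F), finrank F A = 2 → P.submodule ≤ A → A ≤ K →
      (projPts A ∩ E).card ≤ 1) :
    E.card ≤ ∑ i ∈ Finset.range (n - 1), Fintype.card F ^ i := by
  have hmap : finrank F (K.map P.submodule.mkQ) = n - 1 := by
    have h1 := finrank_comap_of_surjective _ P.submodule.mkQ_surjective
      (K.map P.submodule.mkQ)
    rw [Submodule.comap_map_eq, Submodule.ker_mkQ, sup_eq_left.2 hPK, hK, finrank_submodule] at h1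
    omega
  rw [← card_projPts hmap]
  have h1 := sum_card_comap_mkQ P.submodule E
  rw [projPts_point, Finset.sdiff_singleton_eq_erase, Finset.erase_eq_of_notMem hPE] at h1
  rw [← h1, Finset.card_eq_sum_ones, ← Finset.sum_subset (Finset.subset_univ
    (projPts (K.map P.submodule.mkQ)))]
  · have hle : ∀ x : Projectivization F ((Fin (n + 1) → F) ⧸ P.submodule),
        x ∈ projPts (K.map P.submodule.mkQ) →
        ((projPts (x.submodule.comap P.submodule.mkQ) ∩ E) \ {P}).card ≤ 1 := by
      intro x hx
      rw [mem_projPts] at hx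
      refine (Finset.card_le_card Finset.sdiff_subset).trans (h _ ?_ ?_ ?_)
      · rw [finrank_comap_mkQ, finrank_submodule]
      · exact (Submodule.ker_mkQ _).symm.le.trans (LinearMap.ker_le_comap _)
      · refine (Submodule.comap_mono hx).trans ?_
        rw [Submodule.comap_map_eq, Submodule.ker_mkQ, sup_eq_left.2 hPK]
    exact Finset.sum_le_sum hle
  · intro x _ hx
    rw [Finset.card_eq_zero, Finset.eq_empty_iff_forall_notMem]
    intro Q hQ
    rw [Finset.mem_sdiff, Finset.mem_inter, Finset.mem_singleton, mem_projPts, submodule_le_iff,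
      Submodule.mem_comap] at hQ
    have h0 : P.submodule.mkQ Q.rep ≠ 0 := fun h0 => hQ.2
      (eq_of_submodule_le (submodule_le_iff.2 ((Submodule.Quotient.mk_eq_zero _).1 h0)))
    apply hx
    rw [mem_projPts, ← eq_of_submodule_le ((mk_submodule_le_iff h0).2 hQ.1.1), mk_submodule_le_iff]
    exact Submodule.mem_map_of_mem (submodule_le_iff.1 (mem_projPts.1 (hEK hQ.1.2)))

variable [Fact p.Prime] [CharP F p] {c : Pt F n → ZMod p}

/-- Some hyperplane multiple can be subtracted from a light code word to make it much lighter. -/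
theorem exists_sub_hyperplane (hc : c ∈ code F p n) (hn : 2 ≤ n) (hq : 3 ≤ Fintype.card F)
    (hw : (suppF c).card ≤
      (3 * Fintype.card F - 6) * ∑ i ∈ Finset.range (n - 1), Fintype.card F ^ i + 2)
    (hc0 : c ≠ 0) :
    Fintype.card F ^ (n - 1) ≤ (suppF c).card ∧
    ∃ K : Submodule F (Fin (n + 1) → F), finrank F K = n ∧ ∃ a : ZMod p,
      (suppF (c - a • incVec p K)).card + Fintype.card F ^ (n - 1) ≤
        (suppF c).card + ∑ i ∈ Finset.range (n - 1), Fintype.card F ^ i := by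
  obtain ⟨κ, hκ⟩ := exists_line_sum hc
  obtain ⟨P, hP, hPall⟩ : ∃ P, c P ≠ 0 ∧ (c P ≠ κ ∨ ∀ Q, c Q ≠ 0 → c Q = κ) := by
    by_cases h : ∀ Q, c Q ≠ 0 → c Q = κ
    · obtain ⟨P, hP⟩ := Function.ne_iff.1 hc0
      exact ⟨P, hP, Or.inr h⟩
    · push Not at h
      obtain ⟨P, hP, hPκ⟩ := h
      exact ⟨P, hP, Or.inl hPκ⟩
  set L : Set (Submodule F (Fin (n + 1) → F)) := {A | finrank F A = 2 ∧ P.submodule ≤ A ∧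
    Fintype.card F ≤ (projPts A ∩ suppF c).card}
  have hplane : ∀ U : Submodule F (Fin (n + 1) → F), finrank F U = 3 → P.submodule ≤ U →
      ∃ A ∈ L, A ≤ U := by
    intro U hU hPU
    obtain ⟨g, hg, hPg, hgs⟩ := (hankelPlane_code hc hU).exists_long_line (P := P) hq
      (fun g hg => by
        obtain ⟨g, hg₂, hgU, rfl⟩ := mem_linesIn.1 hg
        rw [projPts_inter_inter hgU]
        exact (secant_spec hc hn hq hw hg₂).1)
      (fun h3 g hg => by
        obtain ⟨g, hg₂, hgU, rfl⟩ := mem_linesIn.1 hg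
        rw [projPts_inter_inter hgU]
        exact (secant_spec hc hn hq hw hg₂).2 h3)
      (Finset.mem_inter.2 ⟨mem_projPts.2 hPU, mem_suppF.2 hP⟩)
    obtain ⟨g, hg₂, hgU, rfl⟩ := mem_linesIn.1 hg
    rw [projPts_inter_inter hgU] at hgs
    exact ⟨g, ⟨hg₂, mem_projPts.1 hPg, hgs⟩, hgU⟩
  have hcone : ∀ A ∈ L, ∀ B ∈ L, A ≠ B → ∀ f : Submodule F (Fin (n + 1) → F), finrank F f = 2 →
      P.submodule ≤ f → f ≤ A ⊔ B → f ∈ L := by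
    intro A hA B hB hAB f hf hPf hfAB
    have h1 := Submodule.finrank_sup_add_finrank_inf_eq A B
    have h2 := Submodule.finrank_mono (le_inf hA.2.1 hB.2.1)
    rw [finrank_submodule] at h2
    have h3 : finrank F (A ⊓ B : Submodule F _) < 2 := by
      by_contra! h3
      have e1 := Submodule.eq_of_le_of_finrank_le (inf_le_left : A ⊓ B ≤ A) (by rw [hA.1]; exact h3)
      have e2 := Submodule.eq_of_le_of_finrank_le (inf_le_right : A ⊓ B ≤ B) (by rw [hB.1]; exact h3)
      exact hAB (e1.symm.trans e2)
    have hAB3 : finrank F (A ⊔ B : Submodule F _) = 3 := by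
      rw [hA.1, hB.1] at h1
      omega
    exact ⟨hf, hPf, long_of_two_long hc hn hq hw hκ hP hPall hAB3 hA.1 hB.1 hf hAB le_sup_left
      le_sup_right hfAB hA.2.1 hB.2.1 hPf hA.2.2 hB.2.2⟩
  have hLne : L.Nonempty := by
    obtain ⟨U, hPU, -, hU⟩ := exists_le_finrank_eq (le_top (a := P.submodule)) (k := 3)
      (by rw [finrank_submodule]; omega) (by rw [finrank_top, finrank_fin_fun]; omega)
    obtain ⟨A, hA, -⟩ := hplane U hU hPU
    exact ⟨A, hA⟩
  set W := coneSubmodule P L hLne (fun A hA => hA.2.1) hcone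
  have hmemW : ∀ v, v ∈ W ↔ ∃ A ∈ L, v ∈ A := fun v => Iff.rfl
  have hLW : ∀ A ∈ L, A ≤ W := fun A hA v hv => (hmemW v).2 ⟨A, hA, hv⟩
  have hPW : P.submodule ≤ W := by
    obtain ⟨A, hA⟩ := hLne
    exact hA.2.1.trans (hLW A hA)
  have hWn : n ≤ finrank F W := by
    refine le_finrank_of_meets_planes hPW fun U hU hPU => ?_
    obtain ⟨A, hA, hAU⟩ := hplane U hU hPU
    exact ⟨A, hA.1, hAU, hLW A hA⟩
  obtain ⟨K, hPK, hKW, hK⟩ := exists_le_finrank_eq hPW (k := n)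
    (by rw [finrank_submodule]; omega) hWn
  set E := (projPts K).filter fun Q => c Q ≠ c P with hE
  have hlong : ∀ A : Submodule F (Fin (n + 1) → F), finrank F A = 2 → P.submodule ≤ A → A ≤ K →
      A ∈ L := by
    intro A hA hPA hAK
    obtain ⟨v, hvA, hvP⟩ := SetLike.not_le_iff_exists.1 (fun h : A ≤ P.submodule => by
      have := Submodule.finrank_mono h
      rw [finrank_submodule] at this
      omega)
    obtain ⟨A', hA', hvA'⟩ := (hmemW v).1 (hKW (hAK hvA))
    have hr : ∀ B : Submodule F (Fin (n + 1) → F), finrank F B = 2 →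
        finrank F B ≤ finrank F P.submodule + 1 := fun B hB => by
      rw [hB, finrank_submodule]
    rw [← sup_span_eq_of_finrank hPA (hr A hA) hvA hvP,
      sup_span_eq_of_finrank hA'.2.1 (hr A' hA'.1) hvA' hvP]
    exact hA'
  have hEcard : E.card ≤ ∑ i ∈ Finset.range (n - 1), Fintype.card F ^ i := by
    refine card_le_of_lines_le_one hK hPK (Finset.filter_subset _ _) (by simp [hE]) ?_
    intro A hA hPA hAK
    obtain ⟨z, hz, hzκ, a, ha0, ha⟩ := long_line_spec hc hn hq hw hκ hA (hlong A hA hPA hAK).2.2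
    have hPA' : P ∈ projPts A := mem_projPts.2 hPA
    refine (Finset.card_le_card fun Q hQ => ?_).trans (Finset.card_singleton z).le
    rw [Finset.mem_inter, hE, Finset.mem_filter] at hQ
    rw [Finset.mem_singleton]
    by_contra hQz
    have hQa := ha Q hQ.1 hQz
    apply hQ.2.2
    by_cases hPz : P = z
    · have h1 := hPall.resolve_left (fun h => h (by rw [hPz, hzκ]))
      rw [h1 P hP, h1 Q (by rw [hQa]; exact ha0)]
    · rw [hQa, ha P hPA' hPz]
  have hKcard := card_projPts hK
  obtain ⟨m, rfl⟩ : ∃ m, n = m + 1 := ⟨n - 1, by omega⟩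
  rw [Finset.sum_range_succ] at hKcard
  simp only [Nat.add_sub_cancel] at hEcard hKcard ⊢
  have hKE : projPts K \ E ⊆ projPts K ∩ suppF c := by
    intro Q hQ
    rw [Finset.mem_sdiff, hE, Finset.mem_filter] at hQ
    refine Finset.mem_inter.2 ⟨hQ.1, mem_suppF.2 ?_⟩
    have : c Q = c P := by
      by_contra h
      exact hQ.2 ⟨hQ.1, h⟩
    rw [this]
    exact hP
  have h1 := Finset.card_le_card hKE
  have h2 := Finset.le_card_sdiff E (projPts K)
  have h3 := Finset.card_inter_add_card_sdiff (suppF c) (projPts K)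
  rw [Finset.inter_comm] at h3
  refine ⟨by omega, K, hK, c P, ?_⟩
  have h4 : suppF (c - c P • incVec p K) ⊆ (suppF c \ projPts K) ∪ E := by
    intro Q hQ
    rw [mem_suppF, Pi.sub_apply, Pi.smul_apply, incVec, smul_eq_mul] at hQ
    rw [Finset.mem_union, Finset.mem_sdiff, hE, Finset.mem_filter, mem_suppF, mem_projPts]
    by_cases h : ptIn Q K
    · right
      rw [if_pos h, mul_one] at hQ
      exact ⟨h, sub_ne_zero.1 hQ⟩
    · left
      rw [if_neg h, mul_zero, sub_zero] at hQ
      exact ⟨hQ, h⟩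
  have h5 := (Finset.card_le_card h4).trans (Finset.card_union_le _ _)
  omega

theorem eq_sum_of_card_le (hc : c ∈ code F p n) (hn : 2 ≤ n) (hq : 3 ≤ Fintype.card F)
    (hw : (suppF c).card ≤
      (3 * Fintype.card F - 6) * ∑ i ∈ Finset.range (n - 1), Fintype.card F ^ i + 2) :
    ∃ H₁ H₂ : Submodule F (Fin (n + 1) → F), finrank F H₁ = n ∧ finrank F H₂ = n ∧ H₁ ≠ H₂ ∧
      ∃ a b : ZMod p, c = a • incVec p H₁ + b • incVec p H₂ := by
  have hpad : ∀ H : Submodule F (Fin (n + 1) → F), finrank F H = n → ∀ a : ZMod p,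
      c = a • incVec p H → ∃ H₁ H₂ : Submodule F (Fin (n + 1) → F), finrank F H₁ = n ∧
        finrank F H₂ = n ∧ H₁ ≠ H₂ ∧ ∃ a b : ZMod p, c = a • incVec p H₁ + b • incVec p H₂ := by
    intro H hH a hca
    obtain ⟨H', hH', hne⟩ := exists_hyperplane_ne (by omega) H
    exact ⟨H, H', hH, hH', hne.symm, a, 0, by rw [zero_smul, add_zero, hca]⟩
  by_cases hc0 : c = 0
  · obtain ⟨H, hH, -⟩ := exists_hyperplane_ne (F := F) (n := n) (by omega) ⊤
    exact hpad H hH 0 (by rw [hc0, zero_smul])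
  obtain ⟨-, K, hK, a, h1⟩ := exists_sub_hyperplane hc hn hq hw hc0
  have hc1 : c - a • incVec p K ∈ code F p n :=
    (code F p n).sub_mem hc ((code F p n).smul_mem a (incVec_mem_code hK))
  set c₁ := c - a • incVec p K with hc₁
  by_cases hc10 : c₁ = 0
  · exact hpad K hK a (sub_eq_zero.1 hc10)
  have hN : (Fintype.card F - 1) * ∑ i ∈ Finset.range (n - 1), Fintype.card F ^ i + 1 =
      Fintype.card F ^ (n - 1) := by
    have h := Nat.geomSum_eq (m := Fintype.card F) (by omega) (n - 1)
    have h' := Nat.sub_one_dvd_pow_sub_one (Fintype.card F) (n - 1)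
    rw [h, Nat.mul_div_cancel' h']
    have := Nat.one_le_pow (n - 1) (Fintype.card F) (by omega)
    omega
  obtain ⟨r, hr⟩ := Nat.exists_eq_add_of_le hq
  set θ := ∑ i ∈ Finset.range (n - 1), Fintype.card F ^ i
  have e1 : (3 * Fintype.card F - 6) * θ = 3 * (r * θ) + 3 * θ := by
    rw [hr, show 3 * (3 + r) - 6 = 3 * r + 3 by omega]; ring
  have e2 : (Fintype.card F - 1) * θ = r * θ + 2 * θ := by
    rw [hr, show 3 + r - 1 = r + 2 by omega]; ring
  rw [e1] at hw
  rw [e2] at hN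
  have hw1 : (suppF c₁).card ≤ (3 * Fintype.card F - 6) * θ + 2 := by
    rw [e1]; omega
  obtain ⟨-, K', hK', b, h2⟩ := exists_sub_hyperplane hc1 hn hq hw1 hc10
  have hc2 : c₁ - b • incVec p K' ∈ code F p n :=
    (code F p n).sub_mem hc1 ((code F p n).smul_mem b (incVec_mem_code hK'))
  have hc20 : c₁ - b • incVec p K' = 0 := by
    by_contra hne
    have h3 := (exists_sub_hyperplane hc2 hn hq (by rw [e1]; omega) hne).1
    omega
  have hcab : c = a • incVec p K + b • incVec p K' := by
    rw [← sub_eq_zero.1 hc20, hc₁, add_sub_cancel]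
  by_cases hKK : K = K'
  · subst hKK
    exact hpad K hK (a + b) (by rw [add_smul, hcab])
  · exact ⟨K, K', hK, hK', hKK, a, b, hcab⟩

theorem eq_zero_of_card_le_two (hc : c ∈ code F p n) (hn : 2 ≤ n) (hw : (suppF c).card ≤ 2) :
    c = 0 := by
  by_contra hc0
  obtain ⟨P, hP⟩ := Function.ne_iff.1 hc0
  obtain ⟨U, hPU, -, hU⟩ := exists_le_finrank_eq (le_top (a := P.submodule)) (k := 3)
    (by rw [finrank_submodule]; omega) (by rw [finrank_top, finrank_fin_fun]; omega)
  have h2 : 2 ≤ Fintype.card F := Fintype.one_lt_card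
  have h := (hankelPlane_code hc hU).card_S_ge h2
    ⟨P, Finset.mem_inter.2 ⟨mem_projPts.2 hPU, mem_suppF.2 hP⟩⟩
  have h3 := Finset.card_le_card (Finset.inter_subset_right : projPts U ∩ suppF c ⊆ suppF c)
  omega

end Final

theorem theta_sub_two {q n : ℕ} (hn : 2 ≤ n) :
    theta q ((n : ℤ) - 2) = ∑ i ∈ Finset.range (n - 1), q ^ i := by
  rw [theta, if_neg (by omega), show ((n : ℤ) - 2).toNat + 1 = n - 1 by omega]

/-- Theorem 17 of the paper: a code word of weight at most
`min {(3q-6)θ_{n-2}+2, B_{n,q}}` is a linear combination of at most two distinct hyperplanes. -/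
theorem statement2 [Fintype F] {p h q n : ℕ} [Fact p.Prime] (hh : 1 ≤ h) (hq : q = p ^ h)
    (hF : Fintype.card F = q) (hn : 2 ≤ n)
    (c : Pt F n → ZMod p) (hc : c ∈ code F p n)
    (hwt : (wt c : ℝ) ≤ min ((3 * (q : ℝ) - 6) * (theta q ((n : ℤ) - 2) : ℝ) + 2) (B n q)) :
    ∃ H₁ H₂ : Submodule F (Fin (n + 1) → F), Module.finrank F H₁ = n ∧
      Module.finrank F H₂ = n ∧ H₁ ≠ H₂ ∧
      ∃ a b : ZMod p, c = a • incVec p H₁ + b • incVec p H₂ := by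
  have : CharP F p := charP_of_card_eq_prime_pow (f := h) (by rw [hF, hq])
  have h2 : 2 ≤ q := hF ▸ Fintype.one_lt_card
  have hw := hwt.trans (min_le_left _ _)
  rw [theta_sub_two hn, wt_eq_card] at hw
  have hw' : (suppF c).card ≤ (3 * Fintype.card F - 6) *
      ∑ i ∈ Finset.range (n - 1), Fintype.card F ^ i + 2 := by
    rw [hF]
    rw [← Nat.cast_le (α := ℝ)]
    push_cast [Nat.cast_sub (show 6 ≤ 3 * q by omega)]
    push_cast at hw
    exact hw
  rcases Nat.lt_or_ge q 3 with h3 | h3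
  · have hc0 := eq_zero_of_card_le_two hc hn (by
      rw [hF, show q = 2 by omega] at hw'
      simpa using hw')
    obtain ⟨H, hH, -⟩ := exists_hyperplane_ne (F := F) (n := n) (by omega) ⊤
    obtain ⟨H', hH', hne⟩ := exists_hyperplane_ne (by omega) H
    exact ⟨H, H', hH, hH', hne.symm, 0, 0, by rw [hc0, zero_smul, zero_smul, add_zero]⟩
  · exact eq_sum_of_card_le hc hn (hF ▸ h3) hw'

end PGCode
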